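/- Let V be an optimal computer and let T be a computable real with 0 < T ≤ 1. Then the free energy F_V(T) = −T log₂ Z_V(T) is a well-defined real that is weakly Chaitin T-random and T-compressible. -/

import Mathlib

open Filter Topology

/-- A set of finite binary strings is prefix-free if no string in it is a
proper prefix of another string in it. -/
def PrefixFree (S : Set (List Bool)) : Prop :=
  ∀ p ∈ S, ∀ q ∈ S, p <+: q → p = q

/-- A computer: a partial recursive function from finite binary strings to
finite binary strings whose domain is a nonempty prefix-free set. -/
structure Computer where
  f : List Bool →. List Bool
  partrec : Partrec f
  dom_nonempty : f.Dom.Nonempty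
  dom_prefixFree : PrefixFree f.Dom

/-- A computer `U` is optimal if for each computer `C` there is `d ∈ ℕ` such
that every `p ∈ Dom C` admits `q` with `U(q) = C(p)` and `|q| ≤ |p| + d`. -/
def Optimal (U : Computer) : Prop :=
  ∀ C : Computer, ∃ d : ℕ, ∀ p ∈ C.f.Dom,
    ∃ q : List Bool, U.f q = C.f p ∧ q.length ≤ p.length + d

/-- `H_C(s)`: the length of a shortest program for `C` printing `s`. -/
noncomputable def complexity (C : Computer) (s : List Bool) : ℕ :=
  sInf {n | ∃ p : List Bool, s ∈ C.f p ∧ p.length = n}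

/-- The `i`-th bit (for `i = 0, 1, 2, …`) of the base-two expansion of
`α - ⌊α⌋` with infinitely many zeros. -/
noncomputable def bitOf (α : ℝ) (i : ℕ) : Bool :=
  decide (⌊(α - ⌊α⌋) * 2 ^ (i + 1)⌋ % 2 = 1)

/-- `α↾n`: the first `n` bits of the base-two expansion of `α - ⌊α⌋`
with infinitely many zeros. -/
noncomputable def firstBits (α : ℝ) (n : ℕ) : List Bool :=
  (List.range n).map (bitOf α)

/-- A real `α` is computable if some total recursive `f : ℕ⁺ → ℚ` satisfies
`|α - f n| < 1/n` for all `n ≥ 1`. -/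
def ComputableReal (α : ℝ) : Prop :=
  ∃ f : ℕ → ℚ, Computable f ∧ ∀ n : ℕ, 0 < n → |α - (f n : ℝ)| < 1 / n

/-- `α` is weakly Chaitin `T`-random (w.r.t. the computer `U`). -/
def WeaklyChaitinTRandom (U : Computer) (T α : ℝ) : Prop :=
  ∃ c : ℕ, ∀ n : ℕ, 0 < n → T * n - c ≤ (complexity U (firstBits α n) : ℝ)

/-- `α` is Chaitin `T`-random (w.r.t. the computer `U`). -/
def ChaitinTRandom (U : Computer) (T α : ℝ) : Prop :=
  Tendsto (fun n : ℕ => (complexity U (firstBits α n) : ℝ) - T * n) atTop atTop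

/-- `α` is `T`-compressible (w.r.t. the computer `U`): `H(α↾n) ≤ Tn + o(n)`. -/
def TCompressible (U : Computer) (T α : ℝ) : Prop :=
  ∃ g : ℕ → ℝ, Tendsto (fun n : ℕ => g n / n) atTop (nhds 0) ∧
    ∀ n : ℕ, 0 < n → (complexity U (firstBits α n) : ℝ) ≤ T * n + g n

/-- The Boltzmann factor `2^(-|p|/T)` of a program `p`. -/
noncomputable def boltzmann (T : ℝ) (p : List Bool) : ℝ :=
  (2 : ℝ) ^ (-(p.length : ℝ) / T)

/-- Partition function `Z_C(T) = Σ_{p ∈ Dom C} 2^(-|p|/T)`. -/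
noncomputable def Zfun (C : Computer) (T : ℝ) : ℝ :=
  ∑' p : C.f.Dom, boltzmann T p.1

/-- Free energy `F_C(T) = -T log₂ Z_C(T)`. -/
noncomputable def Ffun (C : Computer) (T : ℝ) : ℝ :=
  -T * Real.logb 2 (Zfun C T)

/-- Energy `E_C(T) = Z_C(T)⁻¹ Σ_{p ∈ Dom C} |p| 2^(-|p|/T)`. -/
noncomputable def Efun (C : Computer) (T : ℝ) : ℝ :=
  (Zfun C T)⁻¹ * ∑' p : C.f.Dom, (p.1.length : ℝ) * boltzmann T p.1

/-- Statistical mechanical entropy `S_C(T) = (E_C(T) - F_C(T))/T`. -/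
noncomputable def Sfun (C : Computer) (T : ℝ) : ℝ :=
  (Efun C T - Ffun C T) / T

/-- `𝒵(V)`: the set of `T ∈ (0,1)` with `Z_V(T)` computable. -/
def setZ (V : Computer) : Set ℝ := {T | T ∈ Set.Ioo 0 1 ∧ ComputableReal (Zfun V T)}

/-- `ℱ(V)`: the set of `T ∈ (0,1)` with `F_V(T)` computable. -/
def setF (V : Computer) : Set ℝ := {T | T ∈ Set.Ioo 0 1 ∧ ComputableReal (Ffun V T)}

/-- `ℰ(V)`: the set of `T ∈ (0,1)` with `E_V(T)` computable. -/
def setE (V : Computer) : Set ℝ := {T | T ∈ Set.Ioo 0 1 ∧ ComputableReal (Efun V T)}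

/-- `𝒮(V)`: the set of `T ∈ (0,1)` with `S_V(T)` computable. -/
def setS (V : Computer) : Set ℝ := {T | T ∈ Set.Ioo 0 1 ∧ ComputableReal (Sfun V T)}

/-- `FP_w` (w.r.t. the optimal computer `U` fixing `H`): the set of `T ∈ (0,1)`
that are weakly Chaitin `T`-random and `T`-compressible. -/
def FPw (U : Computer) : Set ℝ :=
  {T | T ∈ Set.Ioo 0 1 ∧ WeaklyChaitinTRandom U T T ∧ TCompressible U T T}

/-- `FP` (w.r.t. the optimal computer `U` fixing `H`): the set of `T ∈ (0,1)`
that are Chaitin `T`-random and `T`-compressible. -/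
def FP (U : Computer) : Set ℝ :=
  {T | T ∈ Set.Ioo 0 1 ∧ ChaitinTRandom U T T ∧ TCompressible U T T}

/-- A computer is physically reasonable if its domain contains two strings of
different lengths. -/
def PhysicallyReasonable (C : Computer) : Prop :=
  ∃ p ∈ C.f.Dom, ∃ q ∈ C.f.Dom, p.length ≠ q.length

/-- A computable measure machine: `Z_C(1)` is a computable real. -/
def ComputableMeasureMachine (C : Computer) : Prop :=
  ComputableReal (Zfun C 1)

/-- `D` is the composition `C₀ ⊘ C₁ ⊘ ⋯ ⊘ C_{N-1}`: its domain consists of the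
concatenations `p₀p₁⋯p_{N-1}` with each `pᵢ ∈ Dom Cᵢ`, and on such a
concatenation it returns `C₀(p₀)`. -/
def IsComposition {N : ℕ} (C : Fin N → Computer) (hN : 0 < N) (D : Computer) : Prop :=
  (∀ l, l ∈ D.f.Dom ↔
      ∃ ps : Fin N → List Bool, (∀ i, ps i ∈ (C i).f.Dom) ∧ l = (List.ofFn ps).flatten) ∧
  (∀ ps : Fin N → List Bool, (∀ i, ps i ∈ (C i).f.Dom) →
      D.f ((List.ofFn ps).flatten) = (C ⟨0, hN⟩).f (ps ⟨0, hN⟩))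

/-- A sequence of computers is recursive if a single partial recursive function
uniformly computes all of them. -/
def RecursiveSeq (V : ℕ → Computer) : Prop :=
  ∃ F : ℕ × List Bool →. List Bool, Partrec F ∧ ∀ n p, (V n).f p = F (n, p)


/-! ### Generic search lemmas -/

theorem mem_rfind_some {p : ℕ → Bool} {n : ℕ} :
    n ∈ Nat.rfind (fun m => Part.some (p m)) ↔ p n = true ∧ ∀ m < n, p m = false := by
  refine Nat.mem_rfind.trans ?_
  simp only [Part.mem_some_iff]
  constructor
  · rintro ⟨h1, h2⟩
    exact ⟨h1.symm, fun m hm => (h2 hm).symm⟩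
  · rintro ⟨h1, h2⟩
    exact ⟨h1.symm, fun {m} hm => (h2 m hm).symm⟩

theorem partrec_search {α : Type*} [Primcodable α] {p : α → ℕ → Bool} (hp : Computable₂ p) :
    Partrec (fun a => Nat.rfind (fun m => Part.some (p a m))) :=
  Partrec.rfind hp.partrec₂

theorem computable_find {α : Type*} [Primcodable α] {p : α → ℕ → Bool} (hp : Computable₂ p)
    (h : ∀ a, ∃ n, p a n = true) : Computable (fun a => Nat.find (h a)) := by
  refine Partrec.of_eq_tot (partrec_search hp) (fun a => ?_)
  rw [mem_rfind_some]
  refine ⟨Nat.find_spec (h a), fun m hm => ?_⟩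
  simpa using Nat.find_min (h a) hm

/-! ### Computability of numerator and denominator of rationals -/

theorem rat_raw_encode (q : ℚ) :
    @Encodable.encode ℚ Rat.instEncodable q
      = Nat.pair (@Encodable.encode ℤ Int.encodable q.num) q.den := by
  rfl

theorem int_encode_ofNat (k : ℕ) :
    @Encodable.encode ℤ Int.encodable (Int.ofNat k) = 2 * k := by
  rfl

theorem int_encode_negSucc (k : ℕ) :
    @Encodable.encode ℤ Int.encodable (Int.negSucc k) = 2 * k + 1 := by
  rfl

open Encodable in
theorem rat_raw_ofNat (n : ℕ) :
    @encode ℚ Rat.instEncodable (Denumerable.ofNat ℚ n) =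
     @Nat.Subtype.ofNat (Set.range (@encode ℚ Rat.instEncodable)) (@decidableRangeEncode ℚ _)
      (Infinite.of_injective _
        (Equiv.ofInjective _ (@encode_injective ℚ Rat.instEncodable)).injective) n := by
  let := @decidableRangeEncode ℚ Rat.instEncodable
  let : Infinite (Set.range (@encode ℚ Rat.instEncodable)) :=
    Infinite.of_injective _ (Equiv.ofInjective _ (@encode_injective ℚ Rat.instEncodable)).injective
  let := Nat.Subtype.denumerable (Set.range (@encode ℚ Rat.instEncodable))
  have h : Denumerable.ofNat ℚ n =
    (@equivRangeEncode ℚ Rat.instEncodable).symm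
      (Nat.Subtype.ofNat (Set.range (@encode ℚ Rat.instEncodable)) n) :=
    Denumerable.ofEquiv_ofNat _ _ n
  rw [h]
  have := (@equivRangeEncode ℚ Rat.instEncodable).apply_symm_apply
    (Nat.Subtype.ofNat (Set.range (@encode ℚ Rat.instEncodable)) n)
  exact congrArg Subtype.val this

theorem mem_rat_range (m : ℕ) : m ∈ Set.range (@Encodable.encode ℚ Rat.instEncodable) ↔
    0 < m.unpair.2 ∧ ∀ x < m.unpair.2 + 1, (((m.unpair.1 + 1) / 2) % x = 0 ∧
      m.unpair.2 % x = 0) → x = 1 := by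
  constructor
  · rintro ⟨q, rfl⟩
    rw [rat_raw_encode, Nat.unpair_pair]
    refine ⟨q.den_pos, fun x _ ⟨h1, h2⟩ => ?_⟩
    have hc := q.reduced
    have : (@Encodable.encode ℤ Int.encodable q.num + 1) / 2 = q.num.natAbs := by
      cases q.num with
      | ofNat k => rw [int_encode_ofNat]; simp; omega
      | negSucc k => rw [int_encode_negSucc]; simp; omega
    dsimp only at h1 h2
    rw [this] at h1
    exact Nat.eq_one_of_dvd_coprimes hc (Nat.dvd_of_mod_eq_zero h1) (Nat.dvd_of_mod_eq_zero h2)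
  · rintro ⟨h0, h⟩
    have hc : ((m.unpair.1 + 1) / 2).Coprime m.unpair.2 := by
      apply h
      · exact Nat.lt_succ_of_le (Nat.gcd_le_right _ h0)
      · exact ⟨Nat.mod_eq_zero_of_dvd (Nat.gcd_dvd_left _ _),
          Nat.mod_eq_zero_of_dvd (Nat.gcd_dvd_right _ _)⟩
    obtain ⟨k, hk | hk⟩ := Nat.even_or_odd' m.unpair.1
    · refine ⟨⟨Int.ofNat k, m.unpair.2, h0.ne', ?_⟩, ?_⟩
      · have : (m.unpair.1 + 1) / 2 = k := by omega
        rw [this] at hc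
        exact hc
      · rw [rat_raw_encode, int_encode_ofNat, ← hk, Nat.pair_unpair]
    · refine ⟨⟨Int.negSucc k, m.unpair.2, h0.ne', ?_⟩, ?_⟩
      · have : (m.unpair.1 + 1) / 2 = k + 1 := by omega
        rw [this] at hc
        exact hc
      · rw [rat_raw_encode, int_encode_negSucc, ← hk, Nat.pair_unpair]

theorem primrecPred_rat_range :
    PrimrecPred (fun m => m ∈ Set.range (@Encodable.encode ℚ Rat.instEncodable)) := by
  have hu1 : Primrec (fun m : ℕ => m.unpair.1) := Primrec.fst.comp Primrec.unpair
  have hu2 : Primrec (fun m : ℕ => m.unpair.2) := Primrec.snd.comp Primrec.unpair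
  have hR : PrimrecRel (fun x m : ℕ => ((((m.unpair.1 + 1) / 2) % x = 0 ∧
      m.unpair.2 % x = 0) → x = 1)) := by
    have : PrimrecRel (fun x m : ℕ => (¬ (((m.unpair.1 + 1) / 2) % x = 0 ∧
      m.unpair.2 % x = 0) ∨ x = 1)) := by
      refine PrimrecPred.or (PrimrecPred.not (PrimrecPred.and ?_ ?_)) ?_
      · refine Primrec.eq.comp (Primrec.nat_mod.comp (Primrec.nat_div.comp
          (Primrec.succ.comp (hu1.comp Primrec.snd)) (Primrec.const 2)) Primrec.fst)
          (Primrec.const 0)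
      · exact Primrec.eq.comp (Primrec.nat_mod.comp (hu2.comp Primrec.snd) Primrec.fst)
          (Primrec.const 0)
      · exact Primrec.eq.comp Primrec.fst (Primrec.const 1)
    exact this.of_eq (fun x m => by tauto)
  have := hR.forall_lt.comp (Primrec.succ.comp hu2) Primrec.id
  refine (PrimrecPred.and (Primrec.nat_lt.comp (Primrec.const 0) hu2) this).of_eq ?_
  intro m
  rw [mem_rat_range]
  rfl

theorem computable_rat_raw :
    Computable (fun q : ℚ => @Encodable.encode ℚ Rat.instEncodable q) := by
  let := @Encodable.decidableRangeEncode ℚ Rat.instEncodable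
  let : Infinite (Set.range (@Encodable.encode ℚ Rat.instEncodable)) :=
    Infinite.of_injective _
      (Equiv.ofInjective _ (@Encodable.encode_injective ℚ Rat.instEncodable)).injective
  set s := Set.range (@Encodable.encode ℚ Rat.instEncodable) with hs
  have hp : Computable (fun m : ℕ => (decide (m ∈ s) : Bool)) :=
    (primrecPred_rat_range.decide).to_comp
  have hex : ∀ x : ℕ, ∃ m, x + m + 1 ∈ s := by
    intro x
    obtain ⟨y, hy, hxy⟩ := (Set.infinite_coe_iff.mp this).exists_gt x
    exact ⟨y - x - 1, by rwa [show x + (y - x - 1) + 1 = y by omega]⟩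
  have hstep' : Computable (fun x : ℕ => x + Nat.find (hex x) + 1) := by
    have hc : Computable₂ (fun x m : ℕ => (decide (x + m + 1 ∈ s) : Bool)) :=
      hp.comp (Computable.succ.comp
        (Primrec.nat_add.to_comp.comp Computable.fst Computable.snd))
    have hex' : ∀ x : ℕ, ∃ m, (decide (x + m + 1 ∈ s) : Bool) = true := by simpa using hex
    refine (Computable.succ.comp (Primrec.nat_add.to_comp.comp Computable.id
      (computable_find hc hex'))).of_eq (fun x => ?_)
    simp
  have hofNat : Computable (fun n : ℕ => (Nat.Subtype.ofNat s n : ℕ)) := by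
    refine (Computable.nat_rec (f := fun n : ℕ => n)
      (g := fun _ => ((Nat.Subtype.ofNat s 0 : s) : ℕ))
      (h := fun _ p => p.2 + Nat.find (hex p.2) + 1) Computable.id (Computable.const _)
      (hstep'.comp (Computable.snd.comp Computable.snd))).of_eq ?_
    intro n
    induction n with
    | zero => rfl
    | succ n ih =>
      dsimp only at ih ⊢
      rw [ih]
      rfl
  refine (hofNat.comp Computable.encode).of_eq (fun q => ?_)
  have h := rat_raw_ofNat (@Encodable.encode ℚ (Primcodable.ofDenumerable ℚ).toEncodable q)
  rw [show Denumerable.ofNat ℚ (@Encodable.encode ℚ (Primcodable.ofDenumerable ℚ).toEncodable q) = q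
    from Denumerable.ofNat_encode q] at h
  rw [h]
  congr!

theorem computable_rat_den : Computable (fun q : ℚ => q.den) := by
  refine ((Primrec.snd.comp Primrec.unpair).to_comp.comp computable_rat_raw).of_eq (fun q => ?_)
  rw [rat_raw_encode, Nat.unpair_pair]

theorem computable_rat_num : Computable (fun q : ℚ => q.num.toNat) := by
  have h1 : Computable (fun q : ℚ => (@Encodable.encode ℚ Rat.instEncodable q).unpair.1) :=
    (Primrec.fst.comp Primrec.unpair).to_comp.comp computable_rat_raw
  have h2 : Computable (fun i : ℕ => bif i.bodd then 0 else i.div2) :=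
    Computable.cond Computable.nat_bodd (Computable.const 0) Computable.nat_div2
  refine (h2.comp h1).of_eq (fun q => ?_)
  rw [rat_raw_encode, Nat.unpair_pair]
  cases q.num with
  | ofNat k => rw [int_encode_ofNat]; simp [Nat.div2_val]
  | negSucc k => rw [int_encode_negSucc]; simp


open Filter Topology

/-! ### Bracketing `T` and `β = 2^(-1/T)` -/

theorem exists_bounds {T : ℝ} (hT : 0 < T) (hTcomp : ComputableReal T) :
    ∃ a a' b : ℕ → ℕ, Computable a ∧ Computable a' ∧ Computable b ∧ (∀ m, 0 < b m) ∧
      (∀ m, (a m : ℝ) ≤ T * b m) ∧ (∀ m, T * b m ≤ a' m) ∧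
      Tendsto (fun m => (a m : ℝ) / b m) atTop (𝓝 T) ∧
      Tendsto (fun m => (a' m : ℝ) / b m) atTop (𝓝 T) := by
  obtain ⟨f, hf, hfT⟩ := hTcomp
  have hfs : Computable (fun m : ℕ => f (m + 1)) := hf.comp Computable.succ
  have hnum : Computable (fun m : ℕ => (f (m + 1)).num.toNat * (m + 1)) :=
    Primrec.nat_mul.to_comp.comp (computable_rat_num.comp hfs) Computable.succ
  have hden : Computable (fun m : ℕ => (f (m + 1)).den) := computable_rat_den.comp hfs
  have key : ∀ m : ℕ, |T - ((f (m + 1)).num.toNat : ℝ) / (f (m + 1)).den| < 1 / ((m : ℝ) + 1) := by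
    intro m
    have h := hfT (m + 1) (Nat.succ_pos m)
    have hd : (0 : ℝ) < (f (m + 1)).den := by exact_mod_cast (f (m + 1)).den_pos
    have hq : ((f (m + 1) : ℚ) : ℝ) = ((f (m + 1)).num : ℝ) / (f (m + 1)).den := by
      rw [Rat.cast_def]
    push_cast at h
    by_cases h0 : 0 ≤ (f (m + 1)).num
    · have : (((f (m + 1)).num.toNat : ℕ) : ℝ) = ((f (m + 1)).num : ℝ) := by
        have := Int.toNat_of_nonneg h0
        exact_mod_cast congrArg (Int.cast (R := ℝ)) this
      rw [this, ← hq]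
      exact h
    · have h0' : (f (m + 1)).num ≤ 0 := by omega
      rw [Int.toNat_of_nonpos h0']
      have h1 : ((f (m + 1) : ℚ) : ℝ) ≤ 0 := by
        rw [hq]
        exact div_nonpos_of_nonpos_of_nonneg (by exact_mod_cast h0') hd.le
      simp only [Nat.cast_zero, zero_div, sub_zero]
      rw [abs_of_pos hT]
      have := (abs_lt.mp h).2
      linarith
  set ν : ℕ → ℝ := fun m => ((f (m + 1)).num.toNat : ℝ) / (f (m + 1)).den with hν
  have h1m : Tendsto (fun m : ℕ => 1 / ((m : ℝ) + 1)) atTop (𝓝 0) :=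
    tendsto_one_div_add_atTop_nhds_zero_nat
  have hνT : Tendsto ν atTop (𝓝 T) := by
    rw [tendsto_iff_norm_sub_tendsto_zero]
    refine squeeze_zero (fun _ => norm_nonneg _) (fun m => ?_) h1m
    rw [Real.norm_eq_abs, abs_sub_comm]
    exact (key m).le
  have hd : ∀ m, (0 : ℝ) < (f (m + 1)).den := fun m => by exact_mod_cast (f (m + 1)).den_pos
  have hm1 : ∀ m : ℕ, (0 : ℝ) < (m : ℝ) + 1 := fun m => by positivity
  have hup : ∀ m : ℕ, (((f (m + 1)).num.toNat * (m + 1) + (f (m + 1)).den : ℕ) : ℝ) /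
      (((f (m + 1)).den * (m + 1) : ℕ) : ℝ) = ν m + 1 / ((m : ℝ) + 1) := by
    intro m
    have := hd m
    have := hm1 m
    simp only [hν]
    push_cast
    field_simp
  have hlow : ∀ m : ℕ, (((f (m + 1)).num.toNat * (m + 1) - (f (m + 1)).den : ℕ) : ℝ) /
      (((f (m + 1)).den * (m + 1) : ℕ) : ℝ) = max 0 (ν m - 1 / ((m : ℝ) + 1)) := by
    intro m
    have h1 := hd m
    have h2 := hm1 m
    have : ν m - 1 / ((m : ℝ) + 1) = (((f (m + 1)).num.toNat * (m + 1) : ℕ) - ((f (m + 1)).den : ℝ)) /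
      (((f (m + 1)).den * (m + 1) : ℕ) : ℝ) := by
      simp only [hν]
      push_cast
      field_simp
    rw [this]
    rcases le_total ((f (m + 1)).den) ((f (m + 1)).num.toNat * (m + 1)) with h | h
    · rw [Nat.cast_sub h, max_eq_right]
      apply div_nonneg
      · rw [sub_nonneg]; exact_mod_cast h
      · positivity
    · rw [Nat.sub_eq_zero_of_le h, max_eq_left]
      · simp
      · apply div_nonpos_of_nonpos_of_nonneg
        · rw [sub_nonpos]; exact_mod_cast h
        · positivity
  refine ⟨fun m => (f (m + 1)).num.toNat * (m + 1) - (f (m + 1)).den,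
    fun m => (f (m + 1)).num.toNat * (m + 1) + (f (m + 1)).den,
    fun m => (f (m + 1)).den * (m + 1), Primrec.nat_sub.to_comp.comp hnum hden,
    Primrec.nat_add.to_comp.comp hnum hden, Primrec.nat_mul.to_comp.comp hden Computable.succ,
    fun m => Nat.mul_pos (f (m + 1)).den_pos (Nat.succ_pos m), fun m => ?_, fun m => ?_, ?_, ?_⟩
  · rw [← div_le_iff₀ (by have := hd m; have := hm1 m; push_cast; positivity), hlow]
    have := (abs_lt.mp (key m)).1
    exact max_le hT.le (by linarith)
  · rw [← le_div_iff₀ (by have := hd m; have := hm1 m; push_cast; positivity), hup]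
    have := (abs_lt.mp (key m)).2
    linarith
  · simp_rw [hlow]
    have := (tendsto_const_nhds (x := (0 : ℝ))).max (hνT.sub h1m)
    simpa [max_eq_right hT.le] using this
  · simp_rw [hup]
    simpa using hνT.add h1m

theorem low_cert_sound {T : ℝ} (hT : 0 < T) {a b u w : ℕ} (hw : 0 < w)
    (hab : (a : ℝ) ≤ T * b) (h : 2 ^ b * u ^ a < w ^ a) :
    (u : ℝ) / w < (2 : ℝ) ^ (-1 / T) := by
  have hw' : (0 : ℝ) < w := by exact_mod_cast hw
  rcases Nat.eq_zero_or_pos a with rfl | ha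
  · have : 1 ≤ 2 ^ b := Nat.one_le_two_pow
    simp at h
  have ha' : (0 : ℝ) < a := by exact_mod_cast ha
  by_contra hcon
  push Not at hcon
  have h1 : ((2 : ℝ) ^ (-1 / T)) ^ a ≤ ((u : ℝ) / w) ^ a := by gcongr
  have h2 : (2 : ℝ) ^ (-(b : ℝ)) ≤ ((2 : ℝ) ^ (-1 / T)) ^ a := by
    rw [← Real.rpow_natCast, ← Real.rpow_mul (by norm_num)]
    apply Real.rpow_le_rpow_of_exponent_le (by norm_num)
    rw [div_mul_eq_mul_div, le_div_iff₀ hT]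
    linarith
  have h3 : (2 : ℝ) ^ b * (u : ℝ) ^ a < (w : ℝ) ^ a := by exact_mod_cast h
  have h4 := h2.trans h1
  rw [Real.rpow_neg (by norm_num), Real.rpow_natCast, div_pow, le_div_iff₀ (by positivity),
    inv_mul_le_iff₀ (by positivity)] at h4
  linarith

theorem up_cert_sound {T : ℝ} (hT : 0 < T) {a b v w : ℕ} (hw : 0 < w) (hb : 0 < b)
    (hab : T * b ≤ a) (h : w ^ a < 2 ^ b * v ^ a) :
    (2 : ℝ) ^ (-1 / T) < (v : ℝ) / w := by
  have hw' : (0 : ℝ) < w := by exact_mod_cast hw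
  by_contra hcon
  push Not at hcon
  have h1 : ((v : ℝ) / w) ^ a ≤ ((2 : ℝ) ^ (-1 / T)) ^ a := by gcongr
  have h2 : ((2 : ℝ) ^ (-1 / T)) ^ a ≤ (2 : ℝ) ^ (-(b : ℝ)) := by
    rw [← Real.rpow_natCast, ← Real.rpow_mul (by norm_num)]
    apply Real.rpow_le_rpow_of_exponent_le (by norm_num)
    rw [div_mul_eq_mul_div, div_le_iff₀ hT]
    linarith
  have h3 : (w : ℝ) ^ a < (2 : ℝ) ^ b * (v : ℝ) ^ a := by exact_mod_cast h
  have h4 := h1.trans h2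
  rw [Real.rpow_neg (by norm_num), Real.rpow_natCast, div_pow, div_le_iff₀ (by positivity),
    le_inv_mul_iff₀ (by positivity)] at h4
  linarith

theorem low_cert_complete {T : ℝ} (hT : 0 < T) {a b : ℕ → ℕ} (hb : ∀ m, 0 < b m)
    (hab : Tendsto (fun m => (a m : ℝ) / b m) atTop (𝓝 T)) {u w : ℕ} (hw : 0 < w)
    (h : (u : ℝ) / w < (2 : ℝ) ^ (-1 / T)) :
    ∀ᶠ m in atTop, 2 ^ b m * u ^ a m < w ^ a m := by
  have hw' : (0 : ℝ) < w := by exact_mod_cast hw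
  have h1 : Tendsto (fun m => (2 : ℝ) ^ (-1 / ((a m : ℝ) / b m))) atTop
      (𝓝 ((2 : ℝ) ^ (-1 / T))) := by
    refine Tendsto.rpow tendsto_const_nhds (tendsto_const_nhds.div hab hT.ne') (Or.inl (by norm_num))
  filter_upwards [h1.eventually_const_lt h, hab.eventually_const_lt hT] with m hm hm0
  have hb' : (0 : ℝ) < b m := by exact_mod_cast hb m
  have ha' : (0 : ℝ) < a m := by
    rcases (div_pos_iff.mp hm0) with h | h
    · exact h.1
    · linarith [h.2]
  have ha0 : a m ≠ 0 := by
    rintro h; rw [h] at ha'; simp at ha'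
  have h2 : ((u : ℝ) / w) ^ a m < ((2 : ℝ) ^ (-1 / ((a m : ℝ) / b m))) ^ a m := by
    gcongr
  have h3 : ((2 : ℝ) ^ (-1 / ((a m : ℝ) / b m))) ^ a m = (2 : ℝ) ^ (-(b m : ℝ)) := by
    rw [← Real.rpow_natCast, ← Real.rpow_mul (by norm_num)]
    congr 1
    field_simp
  rw [h3, Real.rpow_neg (by norm_num), Real.rpow_natCast, div_pow, div_lt_iff₀ (by positivity),
    lt_inv_mul_iff₀ (by positivity)] at h2
  exact_mod_cast h2

theorem up_cert_complete {T : ℝ} (hT : 0 < T) {a b : ℕ → ℕ} (hb : ∀ m, 0 < b m)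
    (hab : Tendsto (fun m => (a m : ℝ) / b m) atTop (𝓝 T)) {v w : ℕ} (hw : 0 < w)
    (h : (2 : ℝ) ^ (-1 / T) < (v : ℝ) / w) :
    ∀ᶠ m in atTop, w ^ a m < 2 ^ b m * v ^ a m := by
  have hw' : (0 : ℝ) < w := by exact_mod_cast hw
  have h1 : Tendsto (fun m => (2 : ℝ) ^ (-1 / ((a m : ℝ) / b m))) atTop
      (𝓝 ((2 : ℝ) ^ (-1 / T))) := by
    refine Tendsto.rpow tendsto_const_nhds (tendsto_const_nhds.div hab hT.ne') (Or.inl (by norm_num))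
  filter_upwards [h1.eventually_lt_const h, hab.eventually_const_lt hT] with m hm hm0
  have hb' : (0 : ℝ) < b m := by exact_mod_cast hb m
  have ha' : (0 : ℝ) < a m := by
    rcases (div_pos_iff.mp hm0) with h | h
    · exact h.1
    · linarith [h.2]
  have ha0 : a m ≠ 0 := by
    rintro h; rw [h] at ha'; simp at ha'
  have h2 : ((2 : ℝ) ^ (-1 / ((a m : ℝ) / b m))) ^ a m < ((v : ℝ) / w) ^ a m := by
    gcongr
  have h3 : ((2 : ℝ) ^ (-1 / ((a m : ℝ) / b m))) ^ a m = (2 : ℝ) ^ (-(b m : ℝ)) := by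
    rw [← Real.rpow_natCast, ← Real.rpow_mul (by norm_num)]
    congr 1
    field_simp
  rw [h3, Real.rpow_neg (by norm_num), Real.rpow_natCast, div_pow, lt_div_iff₀ (by positivity),
    inv_mul_lt_iff₀ (by positivity)] at h2
  exact_mod_cast h2


open Filter Topology

/-! ### Approximating the free energy of finite lists of lengths -/

/-- `∑ x^l` over a list of exponents. -/
noncomputable def listP (x : ℝ) (l : List ℕ) : ℝ := (l.map (fun i => x ^ i)).sum

def listS (u w M : ℕ) (l : List ℕ) : ℕ := l.foldr (fun i s => u ^ i * w ^ (M - i) + s) 0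

def listSum (l : List ℕ) : ℕ := l.foldr (fun i s => i + s) 0

theorem le_listSum {l : List ℕ} {i : ℕ} (h : i ∈ l) : i ≤ listSum l := by
  induction l with
  | nil => simp at h
  | cons a l ih =>
    simp only [listSum, List.foldr_cons] at ih ⊢
    rcases List.mem_cons.mp h with rfl | h
    · omega
    · have := ih h
      omega

theorem listS_eq {u w M : ℕ} (hw : 0 < w) (l : List ℕ) (h : ∀ i ∈ l, i ≤ M) :
    (listS u w M l : ℝ) = (w : ℝ) ^ M * listP ((u : ℝ) / w) l := by
  have hw' : (w : ℝ) ≠ 0 := by exact_mod_cast hw.ne'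
  induction l with
  | nil => simp [listS, listP]
  | cons a l ih =>
    have ih' := ih (fun i hi => h i (List.mem_cons_of_mem _ hi))
    have ha := h a List.mem_cons_self
    simp only [listS, List.foldr_cons, listP, List.map_cons, List.sum_cons] at ih' ⊢
    push_cast
    rw [ih', mul_add, div_pow]
    congr 1
    rw [← Nat.sub_add_cancel ha, pow_add, Nat.sub_add_cancel ha]
    field_simp

theorem listP_mono {x y : ℝ} (hx : 0 ≤ x) (hxy : x ≤ y) (l : List ℕ) : listP x l ≤ listP y l :=
  List.sum_le_sum (fun i _ => pow_le_pow_left₀ hx hxy i)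

theorem listP_nonneg {x : ℝ} (hx : 0 ≤ x) (l : List ℕ) : 0 ≤ listP x l := by
  apply List.sum_nonneg
  intro y hy
  obtain ⟨i, _, rfl⟩ := List.mem_map.mp hy
  positivity

theorem continuous_listP (l : List ℕ) : Continuous (fun x => listP x l) := by
  induction l with
  | nil => simp only [listP, List.map_nil, List.sum_nil]; exact continuous_const
  | cons a l ih =>
    simp only [listP, List.map_cons, List.sum_cons] at ih ⊢
    exact (continuous_pow a).add ih

theorem primrec_pow : Primrec₂ (fun a b : ℕ => a ^ b) :=
  Primrec₂.unpaired'.1 Nat.Primrec.pow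

theorem primrec_listSum : Primrec listSum :=
  Primrec.list_foldr (f := fun l : List ℕ => l) (g := fun _ => 0) (h := fun _ p => p.1 + p.2)
    Primrec.id (Primrec.const 0)
    (Primrec.nat_add.comp (Primrec.fst.comp Primrec.snd) (Primrec.snd.comp Primrec.snd))

theorem primrec_listS : Primrec (fun p : (ℕ × ℕ) × ℕ × List ℕ => listS p.1.1 p.1.2 p.2.1 p.2.2) := by
  refine Primrec.list_foldr (f := fun p : (ℕ × ℕ) × ℕ × List ℕ => p.2.2) (g := fun _ => 0)
    (h := fun p q => p.1.1 ^ q.1 * p.1.2 ^ (p.2.1 - q.1) + q.2)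
    (Primrec.snd.comp Primrec.snd) (Primrec.const 0) ?_
  have hi : Primrec (fun z : ((ℕ × ℕ) × ℕ × List ℕ) × (ℕ × ℕ) => z.2.1) :=
    Primrec.fst.comp Primrec.snd
  refine Primrec.nat_add.comp (Primrec.nat_mul.comp (primrec_pow.comp ?_ hi)
    (primrec_pow.comp ?_ (Primrec.nat_sub.comp ?_ hi))) (Primrec.snd.comp Primrec.snd)
  · exact Primrec.fst.comp (Primrec.fst.comp Primrec.fst)
  · exact Primrec.snd.comp (Primrec.fst.comp Primrec.fst)
  · exact Primrec.fst.comp (Primrec.snd.comp Primrec.fst)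

/-- The certificate check. -/
def certOK (n : ℕ) (l : List ℕ) (A u v w a a' b : ℕ) : Prop :=
  0 < w ∧ 2 ^ b * u ^ a < w ^ a ∧ w ^ a' < 2 ^ b * v ^ a' ∧
  v ^ (A + 1) * w ^ (listSum l * 2 ^ n) < w ^ (A + 1) * listS u w (listSum l) l ^ (2 ^ n) ∧
  listS v w (listSum l) l ^ (2 ^ n) * v * w ^ A < w ^ (listSum l * 2 ^ n + 1) * u ^ A

theorem cert1_iff {n A u v w : ℕ} {l : List ℕ} (hw : 0 < w) :
    v ^ (A + 1) * w ^ (listSum l * 2 ^ n) < w ^ (A + 1) * listS u w (listSum l) l ^ (2 ^ n) ↔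
    ((v : ℝ) / w) ^ (A + 1) < listP ((u : ℝ) / w) l ^ (2 ^ n) := by
  have hw' : (0 : ℝ) < w := by exact_mod_cast hw
  rw [← Nat.cast_lt (α := ℝ)]
  push_cast
  rw [listS_eq hw l (fun i hi => le_listSum hi), mul_pow, ← pow_mul, div_pow,
    div_lt_iff₀ (by positivity)]
  rw [show (w : ℝ) ^ (A + 1) * (w ^ (listSum l * 2 ^ n) * listP ((u : ℝ) / w) l ^ 2 ^ n) =
    (listP ((u : ℝ) / w) l ^ 2 ^ n * w ^ (A + 1)) * w ^ (listSum l * 2 ^ n) by ring]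
  exact mul_lt_mul_iff_left₀ (by positivity)

theorem cert2_iff {n A u v w : ℕ} {l : List ℕ} (hw : 0 < w) :
    listS v w (listSum l) l ^ (2 ^ n) * v * w ^ A < w ^ (listSum l * 2 ^ n + 1) * u ^ A ↔
    listP ((v : ℝ) / w) l ^ (2 ^ n) * ((v : ℝ) / w) < ((u : ℝ) / w) ^ A := by
  have hw' : (0 : ℝ) < w := by exact_mod_cast hw
  rw [← Nat.cast_lt (α := ℝ)]
  push_cast
  rw [listS_eq hw l (fun i hi => le_listSum hi), mul_pow, ← pow_mul, div_pow,
    lt_div_iff₀ (by positivity), ← mul_div_assoc, div_mul_eq_mul_div, div_lt_iff₀ hw']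
  rw [show (w : ℝ) ^ (listSum l * 2 ^ n) * listP ((v : ℝ) / w) l ^ 2 ^ n * v * w ^ A =
     (listP ((v : ℝ) / w) l ^ 2 ^ n * v * w ^ A) * (w : ℝ) ^ (listSum l * 2 ^ n) by ring,
    show (w : ℝ) ^ (listSum l * 2 ^ n + 1) * u ^ A =
      (u ^ A * w) * (w : ℝ) ^ (listSum l * 2 ^ n) by ring]
  exact mul_lt_mul_iff_left₀ (by positivity)

theorem logb_beta_pow (T : ℝ) (k : ℕ) :
    Real.logb 2 (((2 : ℝ) ^ (-1 / T)) ^ k) = -k / T := by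
  rw [← Real.rpow_natCast, ← Real.rpow_mul (by norm_num), Real.logb_rpow (by norm_num) (by norm_num)]
  ring

theorem cert_sound {T : ℝ} (hT : 0 < T) {n A u v w a a' b : ℕ} {l : List ℕ} (hb : 0 < b)
    (ha : (a : ℝ) ≤ T * b) (ha' : T * b ≤ a')
    (h : certOK n l A u v w a a' b) {F : ℝ}
    (hF : F = -T * Real.logb 2 (listP ((2 : ℝ) ^ (-1 / T)) l))
    (hZ : 0 < listP ((2 : ℝ) ^ (-1 / T)) l) :
    (A : ℝ) - 1 < 2 ^ n * F ∧ 2 ^ n * F < A + 1 := by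
  obtain ⟨hw, h1, h2, h3, h4⟩ := h
  have hlo := low_cert_sound hT hw ha h1
  have hup := up_cert_sound hT hw hb ha' h2
  rw [cert1_iff hw] at h3
  rw [cert2_iff hw] at h4
  set β : ℝ := (2 : ℝ) ^ (-1 / T) with hβ
  have hβ0 : 0 < β := by positivity
  have hu0 : (0 : ℝ) ≤ (u : ℝ) / w := by positivity
  have e1 : β ^ (A + 1) < listP β l ^ (2 ^ n) :=
    (pow_le_pow_left₀ hβ0.le hup.le _).trans_lt
      (h3.trans_le (pow_le_pow_left₀ (listP_nonneg hu0 l) (listP_mono hu0 hlo.le l) _))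
  have e2 : listP β l ^ (2 ^ n) * β < β ^ A := by
    refine lt_of_le_of_lt ?_ (h4.trans_le (pow_le_pow_left₀ hu0 hlo.le _))
    exact mul_le_mul (pow_le_pow_left₀ hZ.le (listP_mono hβ0.le hup.le l) _) hup.le hβ0.le
      (pow_nonneg (listP_nonneg (by positivity) _) _)
  have f1 := Real.logb_lt_logb (b := 2) (by norm_num) (by positivity) e1
  have f2 := Real.logb_lt_logb (b := 2) (by norm_num) (by positivity) e2
  rw [Real.logb_mul (by positivity) (by positivity)] at f2
  have e3 : Real.logb 2 β = -1 / T := by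
    have h := logb_beta_pow T 1
    rw [pow_one, Nat.cast_one] at h
    exact h
  rw [e3, hβ, logb_beta_pow, ← hβ, Real.logb_pow] at f2
  rw [hβ, logb_beta_pow, ← hβ, Real.logb_pow] at f1
  have hLF : Real.logb 2 (listP β l) = -F / T := by rw [hF]; field_simp
  rw [hLF] at f1 f2
  push_cast at f1 f2
  constructor
  · have := mul_lt_mul_of_pos_right f2 hT
    field_simp at this
    linarith
  · have := mul_lt_mul_of_pos_right f1 hT
    field_simp at this
    linarith

theorem cert_complete {T : ℝ} (hT : 0 < T) {a a' b : ℕ → ℕ} (hb : ∀ m, 0 < b m)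
    (hta : Tendsto (fun m => (a m : ℝ) / b m) atTop (𝓝 T))
    (hta' : Tendsto (fun m => (a' m : ℝ) / b m) atTop (𝓝 T)) (n : ℕ) (l : List ℕ)
    (hZ : 0 < listP ((2 : ℝ) ^ (-1 / T)) l) (hZ1 : listP ((2 : ℝ) ^ (-1 / T)) l ≤ 1) :
    ∃ A u v w m : ℕ, certOK n l A u v w (a m) (a' m) (b m) := by
  set β : ℝ := (2 : ℝ) ^ (-1 / T) with hβ
  have hβ0 : 0 < β := by positivity
  have hβ1 : β < 1 := Real.rpow_lt_one_of_one_lt_of_neg (by norm_num) (by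
    rw [neg_div]; simpa using hT)
  set F : ℝ := -T * Real.logb 2 (listP β l) with hF
  have hF0 : 0 ≤ F := by
    have : Real.logb 2 (listP β l) ≤ 0 := Real.logb_nonpos (by norm_num) hZ.le hZ1
    nlinarith
  set A := ⌊2 ^ n * F⌋₊ with hA
  have hA1 : (A : ℝ) ≤ 2 ^ n * F := Nat.floor_le (by positivity)
  have hA2 : 2 ^ n * F < A + 1 := Nat.lt_floor_add_one _
  have hLF : Real.logb 2 (listP β l) = -F / T := by rw [hF]; field_simp
  have hZpow : listP β l ^ (2 ^ n) = (2 : ℝ) ^ (-(2 ^ n * F) / T) := by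
    rw [← Real.logb_eq_iff_rpow_eq (by norm_num) (by norm_num) (by positivity) |>.mp
      (show Real.logb 2 (listP β l ^ (2 ^ n)) = -(2 ^ n * F) / T by
        rw [Real.logb_pow, hLF]; push_cast; ring)]
  have hβpow : ∀ k : ℕ, β ^ k = (2 : ℝ) ^ (-(k : ℝ) / T) := by
    intro k
    rw [hβ, ← Real.rpow_natCast, ← Real.rpow_mul (by norm_num)]
    congr 1
    ring
  have e1 : β ^ (A + 1) < listP β l ^ (2 ^ n) := by
    rw [hZpow, hβpow]
    apply Real.rpow_lt_rpow_of_exponent_lt (by norm_num)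
    rw [div_lt_div_iff_of_pos_right hT]
    push_cast
    linarith
  have e2 : listP β l ^ (2 ^ n) * β < β ^ A := by
    have : listP β l ^ (2 ^ n) ≤ β ^ A := by
      rw [hZpow, hβpow]
      apply Real.rpow_le_rpow_of_exponent_le (by norm_num)
      rw [div_le_div_iff_of_pos_right hT]
      linarith
    calc listP β l ^ (2 ^ n) * β < listP β l ^ (2 ^ n) * 1 :=
          mul_lt_mul_of_pos_left hβ1 (by positivity)
      _ ≤ β ^ A := by simpa using this
  have hc := continuous_listP l
  have c1 : ∀ᶠ z : ℝ × ℝ in 𝓝 (β, β), z.2 ^ (A + 1) < listP z.1 l ^ (2 ^ n) :=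
    Tendsto.eventually_lt (f := fun z : ℝ × ℝ => z.2 ^ (A + 1))
      (g := fun z : ℝ × ℝ => listP z.1 l ^ (2 ^ n))
      ((continuous_snd.pow _).tendsto _) (((hc.comp continuous_fst).pow _).tendsto _) e1
  have c2 : ∀ᶠ z : ℝ × ℝ in 𝓝 (β, β), listP z.2 l ^ (2 ^ n) * z.2 < z.1 ^ A :=
    Tendsto.eventually_lt (f := fun z : ℝ × ℝ => listP z.2 l ^ (2 ^ n) * z.2)
      (g := fun z : ℝ × ℝ => z.1 ^ A)
      ((((hc.comp continuous_snd).pow _).mul continuous_snd).tendsto _)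
      ((continuous_fst.pow _).tendsto _) e2
  obtain ⟨ε, hε, hball⟩ := Metric.eventually_nhds_iff.mp (c1.and c2)
  obtain ⟨w', hw'⟩ := exists_nat_one_div_lt hε
  set w := w' + 1 with hwdef
  have hw : 0 < w := Nat.succ_pos _
  have hwR : (0 : ℝ) < w := by exact_mod_cast hw
  have hw1 : 1 / (w : ℝ) < ε := by simpa [hwdef] using hw'
  set u := ⌈β * w⌉₊ - 1
  set v := ⌊β * w⌋₊ + 1
  have hcpos : 0 < ⌈β * w⌉₊ := Nat.ceil_pos.mpr (by positivity)
  have hu : (u : ℝ) + 1 = ⌈β * w⌉₊ := by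
    have : u + 1 = ⌈β * w⌉₊ := Nat.sub_add_cancel hcpos
    exact_mod_cast this
  have hu1 : (u : ℝ) < β * w := by
    have := Nat.ceil_lt_add_one (show 0 ≤ β * w by positivity)
    linarith
  have hu2 : β * w - 1 ≤ u := by
    have := Nat.le_ceil (β * w)
    linarith
  have hv1 : β * w < v := by
    have := Nat.lt_floor_add_one (β * w)
    push_cast [v]
    exact this
  have hv2 : (v : ℝ) ≤ β * w + 1 := by
    have := Nat.floor_le (show 0 ≤ β * w by positivity)
    push_cast [v]
    linarith
  have hlo : (u : ℝ) / w < β := by rw [div_lt_iff₀ hwR]; exact hu1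
  have hup : β < (v : ℝ) / w := by rw [lt_div_iff₀ hwR]; exact hv1
  have hlo2 : β - 1 / w ≤ (u : ℝ) / w := by
    rw [le_div_iff₀ hwR, sub_mul, one_div, inv_mul_cancel₀ hwR.ne']; exact hu2
  have hup2 : (v : ℝ) / w ≤ β + 1 / w := by
    rw [div_le_iff₀ hwR, add_mul, one_div, inv_mul_cancel₀ hwR.ne']; exact hv2
  have hz := @hball ((u : ℝ) / w, (v : ℝ) / w) (by
    rw [Prod.dist_eq, max_lt_iff, Real.dist_eq, Real.dist_eq, abs_lt, abs_lt]
    dsimp only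
    refine ⟨⟨?_, ?_⟩, ?_, ?_⟩ <;> linarith)
  obtain ⟨m, hm1, hm2⟩ := ((low_cert_complete hT hb hta hw hlo).and
    (up_cert_complete hT hb hta' hw hup)).exists
  exact ⟨A, u, v, w, m, hw, hm1, hm2, (cert1_iff hw).mpr hz.1, (cert2_iff hw).mpr hz.2⟩


open Filter Topology

theorem computable_lt {α : Type*} [Primcodable α] {f g : α → ℕ} (hf : Computable f)
    (hg : Computable g) : Computable (fun x => decide (f x < g x)) :=
  (Primrec.nat_lt.decide).to_comp.comp hf hg

theorem computable_and {α : Type*} [Primcodable α] {f g : α → Bool} (hf : Computable f)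
    (hg : Computable g) : Computable (fun x => f x && g x) :=
  Primrec.and.to_comp.comp hf hg

theorem computable_pow {α : Type*} [Primcodable α] {f g : α → ℕ} (hf : Computable f)
    (hg : Computable g) : Computable (fun x => f x ^ g x) :=
  primrec_pow.to_comp.comp hf hg

theorem computable_mul {α : Type*} [Primcodable α] {f g : α → ℕ} (hf : Computable f)
    (hg : Computable g) : Computable (fun x => f x * g x) :=
  Primrec.nat_mul.to_comp.comp hf hg

theorem computable_add {α : Type*} [Primcodable α] {f g : α → ℕ} (hf : Computable f)
    (hg : Computable g) : Computable (fun x => f x + g x) :=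
  Primrec.nat_add.to_comp.comp hf hg

theorem computable_sub {α : Type*} [Primcodable α] {f g : α → ℕ} (hf : Computable f)
    (hg : Computable g) : Computable (fun x => f x - g x) :=
  Primrec.nat_sub.to_comp.comp hf hg

open Classical in
theorem computable_certOK {α : Type*} [Primcodable α] {n A u v w a a' b : α → ℕ}
    {l : α → List ℕ} (hn : Computable n) (hA : Computable A) (hu : Computable u)
    (hv : Computable v) (hw : Computable w) (ha : Computable a) (ha' : Computable a')
    (hb : Computable b) (hl : Computable l) :
    Computable (fun x => decide (certOK (n x) (l x) (A x) (u x) (v x) (w x) (a x) (a' x) (b x))) := by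
  have h2 : Computable (fun _ : α => 2) := Computable.const 2
  have hA1 : Computable (fun x => A x + 1) := Computable.succ.comp hA
  have h2b := computable_pow h2 hb
  have h2n := computable_pow h2 hn
  have hM : Computable (fun x => listSum (l x)) := primrec_listSum.to_comp.comp hl
  have hS : ∀ {u : α → ℕ}, Computable u →
      Computable (fun x => listS (u x) (w x) (listSum (l x)) (l x)) := fun hu =>
    primrec_listS.to_comp.comp ((hu.pair hw).pair (hM.pair hl))
  have hM2 := computable_mul hM h2n
  have hM21 : Computable (fun x => listSum (l x) * 2 ^ n x + 1) := Computable.succ.comp hM2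
  refine (computable_and (computable_lt (Computable.const 0) hw) (computable_and
    (computable_lt (computable_mul h2b (computable_pow hu ha)) (computable_pow hw ha))
    (computable_and (computable_lt (computable_pow hw ha') (computable_mul h2b
      (computable_pow hv ha')))
    (computable_and (computable_lt (computable_mul (computable_pow hv hA1) (computable_pow hw hM2))
      (computable_mul (computable_pow hw hA1) (computable_pow (hS hu) h2n)))
     (computable_lt (computable_mul (computable_mul (computable_pow (hS hv) h2n) hv)
      (computable_pow hw hA)) (computable_mul (computable_pow hw hM21)
        (computable_pow hu hA))))))).of_eq (fun x => ?_)
  rw [Bool.eq_iff_iff]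
  simp only [Bool.and_eq_true, decide_eq_true_iff]
  exact Iff.rfl

theorem exists_G {T : ℝ} (hT : 0 < T) (hTcomp : ComputableReal T) {lens : ℕ → List ℕ}
    (hlens : Computable lens) (hZ : ∀ k, 0 < listP ((2 : ℝ) ^ (-1 / T)) (lens k))
    (hZ1 : ∀ k, listP ((2 : ℝ) ^ (-1 / T)) (lens k) ≤ 1) :
    ∃ G : ℕ → ℕ → ℕ, Computable₂ G ∧ ∀ n k,
      (G n k : ℝ) - 1 < 2 ^ n * (-T * Real.logb 2 (listP ((2 : ℝ) ^ (-1 / T)) (lens k))) ∧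
      2 ^ n * (-T * Real.logb 2 (listP ((2 : ℝ) ^ (-1 / T)) (lens k))) < G n k + 1 := by
  classical
  obtain ⟨a, a', b, ha, ha', hb, hb0, hab, hab', hta, hta'⟩ := exists_bounds hT hTcomp
  obtain ⟨D, hDc, hDs⟩ : ∃ D : ℕ → ℕ × ℕ × ℕ × ℕ × ℕ, Computable D ∧ Function.Surjective D :=
    ⟨Denumerable.ofNat (ℕ × ℕ × ℕ × ℕ × ℕ), Computable.ofNat _,
      fun y => ⟨Encodable.encode y, Denumerable.ofNat_encode y⟩⟩
  have hDx : Computable (fun z : (ℕ × ℕ) × ℕ => D z.2) := hDc.comp Computable.snd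
  have hm : Computable (fun z : (ℕ × ℕ) × ℕ => (D z.2).2.2.2.2) :=
    Computable.snd.comp (Computable.snd.comp (Computable.snd.comp (Computable.snd.comp hDx)))
  have hp : Computable₂ (fun (q : ℕ × ℕ) (x : ℕ) =>
      decide (certOK q.1 (lens q.2) (D x).1 (D x).2.1 (D x).2.2.1 (D x).2.2.2.1
        (a (D x).2.2.2.2) (a' (D x).2.2.2.2) (b (D x).2.2.2.2))) := by
    refine computable_certOK (α := (ℕ × ℕ) × ℕ) (n := fun z => z.1.1) (l := fun z => lens z.1.2)
      (A := fun z => (D z.2).1) (u := fun z => (D z.2).2.1) (v := fun z => (D z.2).2.2.1)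
      (w := fun z => (D z.2).2.2.2.1) (a := fun z => a (D z.2).2.2.2.2)
      (a' := fun z => a' (D z.2).2.2.2.2) (b := fun z => b (D z.2).2.2.2.2)
      (Computable.fst.comp Computable.fst) (Computable.fst.comp hDx)
      (Computable.fst.comp (Computable.snd.comp hDx))
      (Computable.fst.comp (Computable.snd.comp (Computable.snd.comp hDx)))
      (Computable.fst.comp (Computable.snd.comp (Computable.snd.comp (Computable.snd.comp hDx))))
      (ha.comp hm) (ha'.comp hm) (hb.comp hm) (hlens.comp (Computable.snd.comp Computable.fst))
  have hex : ∀ q : ℕ × ℕ, ∃ x, decide (certOK q.1 (lens q.2) (D x).1 (D x).2.1 (D x).2.2.1 (D x).2.2.2.1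
        (a (D x).2.2.2.2) (a' (D x).2.2.2.2) (b (D x).2.2.2.2)) = true := by
    intro q
    obtain ⟨A, u, v, w, m, h⟩ := cert_complete hT hb0 hta hta' q.1 (lens q.2) (hZ _) (hZ1 _)
    obtain ⟨x, hx⟩ := hDs (A, u, v, w, m)
    refine ⟨x, ?_⟩
    rw [hx]
    exact decide_eq_true h
  have hfind := computable_find hp hex
  refine ⟨fun n k => (D (Nat.find (hex (n, k)))).1, ?_, fun n k => ?_⟩
  · exact Computable.fst.comp (hDc.comp hfind)
  · have h := Nat.find_spec (hex (n, k))
    rw [decide_eq_true_iff] at h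
    exact cert_sound hT (hb0 _) (hab _) (hab' _) h rfl (hZ k)


open Filter Topology

/-! ### Stage enumeration of a computer -/

theorem exists_stages (V : Computer) :
    ∃ St : ℕ → List (List Bool × List Bool), Computable St ∧
      (∀ k, ((St k).map Prod.fst).Nodup) ∧
      (∀ k k', k ≤ k' → ∀ x ∈ St k, x ∈ St k') ∧
      (∀ k p s, (p, s) ∈ St k → s ∈ V.f p) ∧
      (∀ p s, s ∈ V.f p → ∃ k, (p, s) ∈ St k) ∧
      (∀ k, St k ≠ []) := by
  classical
  obtain ⟨c, hc⟩ := Nat.Partrec.Code.exists_code.mp (Partrec.bind_decode₂_iff.mp V.partrec)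
  let g : ℕ → ℕ → Option (List Bool × List Bool) := fun k n =>
    (Nat.Partrec.Code.evaln k c n).bind (fun y =>
      (Encodable.decode (α := List Bool) n).bind (fun p =>
        (Encodable.decode (α := List Bool) y).map (fun s => (p, s))))
  let St0 : ℕ → List (List Bool × List Bool) := fun k => (List.range k).filterMap (g k)
  have hg : Primrec₂ g := by
    have h1 : Primrec (fun z : ℕ × ℕ => Nat.Partrec.Code.evaln z.1 c z.2) :=
      Nat.Partrec.Code.primrec_evaln.comp ((Primrec.fst.pair (Primrec.const c)).pair Primrec.snd)
    have h2 : Primrec₂ (fun (z : ℕ × ℕ) (y : ℕ) => (Encodable.decode (α := List Bool) z.2).bind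
        (fun p => (Encodable.decode (α := List Bool) y).map (fun s => (p, s)))) := by
      have h3 : Primrec (fun z : (ℕ × ℕ) × ℕ => Encodable.decode (α := List Bool) z.1.2) :=
        Primrec.decode.comp (Primrec.snd.comp Primrec.fst)
      refine Primrec.option_bind h3 ?_
      have h4 : Primrec (fun z : ((ℕ × ℕ) × ℕ) × List Bool =>
          Encodable.decode (α := List Bool) z.1.2) :=
        Primrec.decode.comp (Primrec.snd.comp Primrec.fst)
      refine Primrec.option_map h4 ?_
      exact (Primrec.snd.comp Primrec.fst).pair Primrec.snd
    exact Primrec.option_bind h1 h2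
  have hSt0 : Computable St0 := (Primrec.listFilterMap Primrec.list_range hg).to_comp
  have hmem : ∀ k n p s, (p, s) ∈ g k n → n < k ∧ Encodable.encode p = n ∧ s ∈ V.f p := by
    intro k n p s h
    simp only [g, Option.mem_def, Option.bind_eq_some_iff, Option.map_eq_some_iff,
      Prod.mk.injEq] at h
    obtain ⟨y, hy, p', hp', s', hs', rfl, rfl⟩ := h
    refine ⟨Nat.Partrec.Code.evaln_bound hy, ?_⟩
    have he := Nat.Partrec.Code.evaln_sound hy
    rw [hc] at he
    obtain ⟨q, hq, hy2⟩ := Part.mem_bind_iff.mp he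
    rw [Part.mem_coe] at hq
    have hq' := Encodable.mem_decode₂.mp hq
    obtain ⟨t, ht, hty⟩ := (Part.mem_map_iff _).mp hy2
    rw [← hq', Encodable.encodek, Option.some_inj] at hp'
    rw [← hty, Encodable.encodek, Option.some_inj] at hs'
    subst hp' hs'
    exact ⟨hq', ht⟩
  have hmono : ∀ k k', k ≤ k' → ∀ x ∈ St0 k, x ∈ St0 k' := by
    intro k k' hkk x hx
    simp only [St0, List.mem_filterMap, List.mem_range] at hx ⊢
    obtain ⟨n, hn, hx⟩ := hx
    refine ⟨n, hn.trans_le hkk, ?_⟩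
    simp only [g, Option.bind_eq_some_iff] at hx ⊢
    obtain ⟨y, hy, h⟩ := hx
    exact ⟨y, Nat.Partrec.Code.evaln_mono hkk hy, h⟩
  have hcomp : ∀ p s, s ∈ V.f p → ∃ k, (p, s) ∈ St0 k := by
    intro p s hs
    have he : Encodable.encode s ∈ Nat.Partrec.Code.eval c (Encodable.encode p) := by
      rw [hc]
      refine Part.mem_bind_iff.mpr ⟨p, ?_, ?_⟩
      · rw [Part.mem_coe]
        exact Encodable.mem_decode₂.mpr rfl
      · exact (Part.mem_map_iff _).mpr ⟨s, hs, rfl⟩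
    obtain ⟨k, hk⟩ := Nat.Partrec.Code.evaln_complete.mp he
    refine ⟨k, ?_⟩
    simp only [St0, List.mem_filterMap, List.mem_range]
    refine ⟨Encodable.encode p, Nat.Partrec.Code.evaln_bound hk, ?_⟩
    simp only [g, Option.bind_eq_some_iff, Option.map_eq_some_iff]
    exact ⟨_, hk, p, Encodable.encodek p, s, Encodable.encodek s, rfl⟩
  obtain ⟨p0, hp0⟩ := V.dom_nonempty
  obtain ⟨s0, hs0⟩ := (PFun.mem_dom _ _).mp hp0
  obtain ⟨k0, hk0⟩ := hcomp p0 s0 hs0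
  refine ⟨fun k => St0 (k + k0), ?_, ?_, ?_, ?_, ?_, ?_⟩
  · exact hSt0.comp (computable_add Computable.id (Computable.const k0))
  · intro k
    simp only [St0, List.map_filterMap]
    refine List.Nodup.filterMap ?_ List.nodup_range
    intro n n' p h1 h2
    simp only [Option.mem_def, Option.map_eq_some_iff] at h1 h2
    obtain ⟨⟨p1, s1⟩, h1, rfl⟩ := h1
    obtain ⟨⟨p2, s2⟩, h2, h3⟩ := h2
    have e1 := (hmem _ _ _ _ h1).2.1
    have e2 := (hmem _ _ _ _ h2).2.1
    dsimp only at h3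
    rw [← e1, ← e2, h3]
  · intro k k' h x hx
    exact hmono _ _ (by omega) x hx
  · intro k p s h
    simp only [St0, List.mem_filterMap] at h
    obtain ⟨n, _, h⟩ := h
    exact (hmem _ _ _ _ h).2.2
  · intro p s hs
    obtain ⟨k, hk⟩ := hcomp p s hs
    exact ⟨k, hmono _ _ (by omega) _ hk⟩
  · intro k h
    have := hmono k0 (k + k0) (by omega) _ hk0
    dsimp only at h
    rw [h] at this
    simp at this


open Filter Topology

/-! ### Kraft inequality, partition function -/

theorem kraft {S : Finset (List Bool)} (h : PrefixFree (S : Set (List Bool))) :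
    ∑ p ∈ S, ((1 : ℝ) / 2) ^ p.length ≤ 1 := by
  by_cases h0 : [] ∈ S
  · have : S = {[]} := by
      ext p
      constructor
      · intro hp
        rw [h [] h0 p hp List.nil_prefix]
        simp
      · intro hp
        rw [Finset.mem_singleton.mp hp]
        exact h0
    rw [this]
    simp
  · have hud : InformationTheory.UniquelyDecodable (S : Set (List Bool)) := by
      intro L₁
      induction L₁ with
      | nil =>
        intro L₂ _ h2 he
        cases L₂ with
        | nil => rfl
        | cons b L₂ =>
          exfalso
          have hb : b = [] := (by simpa using he.symm : b = [] ∧ _).1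
          exact h0 (hb ▸ h2 b List.mem_cons_self)
      | cons a L₁ ih =>
        intro L₂ h1 h2 he
        cases L₂ with
        | nil =>
          exfalso
          have ha : a = [] := (by simpa using he : a = [] ∧ _).1
          exact h0 (ha ▸ h1 a List.mem_cons_self)
        | cons b L₂ =>
          have haS := h1 a List.mem_cons_self
          have hbS := h2 b List.mem_cons_self
          rw [List.flatten_cons, List.flatten_cons] at he
          have hab : a = b := by
            rcases List.prefix_or_prefix_of_prefix (l₁ := a) (l₂ := b) (List.prefix_append a _)
              (he ▸ List.prefix_append b _) with hp | hp
            · exact h a haS b hbS hp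
            · exact (h b hbS a haS hp).symm
          subst hab
          rw [ih L₂ (fun w hw => h1 w (List.mem_cons_of_mem _ hw))
            (fun w hw => h2 w (List.mem_cons_of_mem _ hw)) (List.append_cancel_left he)]
    have := InformationTheory.kraft_mcmillan_inequality hud
    simpa using this

theorem boltzmann_pos (T : ℝ) (p : List Bool) : 0 < boltzmann T p := by
  unfold boltzmann; positivity

theorem boltzmann_eq (T : ℝ) (p : List Bool) :
    boltzmann T p = ((2 : ℝ) ^ (-1 / T)) ^ p.length := by
  unfold boltzmann
  rw [← Real.rpow_natCast, ← Real.rpow_mul (by norm_num)]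
  congr 1
  ring

theorem boltzmann_rpow {T : ℝ} (hT : 0 < T) (p : List Bool) :
    boltzmann T p ^ T = (1 / 2) ^ p.length := by
  unfold boltzmann
  rw [← Real.rpow_mul (by norm_num), div_mul_cancel₀ _ hT.ne', Real.rpow_neg (by norm_num),
    Real.rpow_natCast]
  simp

theorem boltzmann_le {T : ℝ} (hT : 0 < T) (hT1 : T ≤ 1) (p : List Bool) :
    boltzmann T p ≤ (1 / 2) ^ p.length := by
  have : ((1 : ℝ) / 2) ^ p.length = (2 : ℝ) ^ (-(p.length : ℝ)) := by
    rw [Real.rpow_neg (by norm_num), Real.rpow_natCast]; simp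
  rw [this]
  unfold boltzmann
  apply Real.rpow_le_rpow_of_exponent_le (by norm_num)
  rw [div_le_iff₀ hT]
  have : (0 : ℝ) ≤ p.length := by positivity
  nlinarith

theorem kraft_dom (V : Computer) {S : Finset (List Bool)} (h : ∀ p ∈ S, p ∈ V.f.Dom) :
    ∑ p ∈ S, ((1 : ℝ) / 2) ^ p.length ≤ 1 :=
  kraft (fun p hp q hq => V.dom_prefixFree p (h p hp) q (h q hq))

theorem sum_boltzmann_le {V : Computer} {T : ℝ} (hT : 0 < T) (hT1 : T ≤ 1)
    {S : Finset (List Bool)} (h : ∀ p ∈ S, p ∈ V.f.Dom) : ∑ p ∈ S, boltzmann T p ≤ 1 :=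
  (Finset.sum_le_sum (fun p _ => boltzmann_le hT hT1 p)).trans (kraft_dom V h)

theorem summable_boltzmann (V : Computer) {T : ℝ} (hT : 0 < T) (hT1 : T ≤ 1) :
    Summable (fun p : V.f.Dom => boltzmann T p.1) := by
  refine summable_of_sum_le (c := 1) (fun p => (boltzmann_pos T p.1).le) (fun u => ?_)
  have := sum_boltzmann_le (V := V) hT hT1 (S := u.map (Function.Embedding.subtype _))
    (fun p hp => by
      obtain ⟨q, _, rfl⟩ := Finset.mem_map.mp hp
      exact q.2)
  rwa [Finset.sum_map] at this

theorem Zfun_pos (V : Computer) {T : ℝ} (hT : 0 < T) (hT1 : T ≤ 1) : 0 < Zfun V T := by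
  obtain ⟨p, hp⟩ := V.dom_nonempty
  exact (summable_boltzmann V hT hT1).tsum_pos (fun p => (boltzmann_pos T p.1).le) ⟨p, hp⟩
    (boltzmann_pos T p)

/-- Everything we need about the computable approximation of the free energy from above. -/
structure Setup (V : Computer) (T : ℝ) where
  St : ℕ → List (List Bool × List Bool)
  compSt : Computable St
  D : ℕ → Finset (List Bool)
  memD : ∀ k p, p ∈ D k ↔ ∃ s, (p, s) ∈ St k
  sound : ∀ k p s, (p, s) ∈ St k → s ∈ V.f p
  domD : ∀ k, ∀ p ∈ D k, p ∈ V.f.Dom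
  monoD : Monotone D
  complete : ∀ p ∈ V.f.Dom, ∃ k, p ∈ D k
  Z : ℕ → ℝ
  F : ℕ → ℝ
  G : ℕ → ℕ → ℕ
  Z_eq : ∀ k, Z k = ∑ p ∈ D k, boltzmann T p
  Z_pos : ∀ k, 0 < Z k
  Z_le : ∀ k, Z k ≤ 1
  F_eq : ∀ k, F k = -T * Real.logb 2 (Z k)
  compG : Computable₂ G
  G_lt : ∀ n k, (G n k : ℝ) - 1 < 2 ^ n * F k
  lt_G : ∀ n k, 2 ^ n * F k < G n k + 1

theorem exists_setup (V : Computer) {T : ℝ} (hT : 0 < T) (hT1 : T ≤ 1)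
    (hTcomp : ComputableReal T) : Nonempty (Setup V T) := by
  obtain ⟨St, hSt, hnd, hmono, hs, hc, hne⟩ := exists_stages V
  let D : ℕ → Finset (List Bool) := fun k => ((St k).map Prod.fst).toFinset
  have hD : ∀ k p, p ∈ D k ↔ ∃ s, (p, s) ∈ St k := by
    intro k p
    simp [D]
  let lens : ℕ → List ℕ := fun k => (St k).map (fun x => x.1.length)
  have hlens : Computable lens := by
    have h : Primrec (fun l : List (List Bool × List Bool) => l.map (fun x => x.1.length)) :=
      Primrec.list_map Primrec.id (Primrec.list_length.comp (Primrec.fst.comp Primrec.snd))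
    exact h.to_comp.comp hSt
  have hdom : ∀ k, ∀ p ∈ D k, p ∈ V.f.Dom := by
    intro k p hp
    obtain ⟨s, h⟩ := (hD k p).mp hp
    exact (PFun.mem_dom _ _).mpr ⟨s, hs k p s h⟩
  have hP : ∀ k, listP ((2 : ℝ) ^ (-1 / T)) (lens k) = ∑ p ∈ D k, boltzmann T p := by
    intro k
    rw [List.sum_toFinset _ (hnd k)]
    simp only [listP, lens, List.map_map]
    congr 1
    apply List.map_congr_left
    intro x _
    simp [boltzmann_eq]
  have hpos : ∀ k, 0 < ∑ p ∈ D k, boltzmann T p := by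
    intro k
    obtain ⟨⟨p, s⟩, hx⟩ := List.exists_mem_of_ne_nil _ (hne k)
    exact Finset.sum_pos (fun p _ => boltzmann_pos T p) ⟨p, (hD k p).mpr ⟨s, hx⟩⟩
  have hle : ∀ k, ∑ p ∈ D k, boltzmann T p ≤ 1 := fun k => sum_boltzmann_le hT hT1 (hdom k)
  obtain ⟨G, hG, hG2⟩ := exists_G hT hTcomp hlens (fun k => (hP k) ▸ hpos k)
    (fun k => (hP k) ▸ hle k)
  refine ⟨{ St := St, compSt := hSt, D := D, memD := hD, sound := hs, domD := hdom,
            monoD := ?_, complete := ?_, Z := fun k => ∑ p ∈ D k, boltzmann T p,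
            F := fun k => -T * Real.logb 2 (∑ p ∈ D k, boltzmann T p), G := G,
            Z_eq := fun _ => rfl, Z_pos := hpos, Z_le := hle, F_eq := fun _ => rfl,
            compG := hG, G_lt := ?_, lt_G := ?_ }⟩
  · intro k k' h p hp
    obtain ⟨s, hx⟩ := (hD k p).mp hp
    exact (hD k' p).mpr ⟨s, hmono k k' h _ hx⟩
  · intro p hp
    obtain ⟨s, hps⟩ := (PFun.mem_dom _ _).mp hp
    obtain ⟨k, hk⟩ := hc p s hps
    exact ⟨k, (hD k p).mpr ⟨s, hk⟩⟩
  · intro n k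
    have := (hG2 n k).1
    rwa [hP] at this
  · intro n k
    have := (hG2 n k).2
    rwa [hP] at this

namespace Setup

variable {V : Computer} {T : ℝ} (S : Setup V T)

theorem monoZ : Monotone S.Z := by
  intro k k' h
  rw [S.Z_eq, S.Z_eq]
  exact Finset.sum_le_sum_of_subset_of_nonneg (S.monoD h) (fun p _ _ => (boltzmann_pos T p).le)

theorem tendsto_Z (hT : 0 < T) (hT1 : T ≤ 1) : Tendsto S.Z atTop (𝓝 (Zfun V T)) := by
  classical
  have hs := (summable_boltzmann V hT hT1).hasSum
  have h1 : Tendsto (fun k => (S.D k).subtype (· ∈ V.f.Dom)) atTop atTop := by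
    apply tendsto_atTop_finset_of_monotone
    · intro k k' h p hp
      rw [Finset.mem_subtype] at hp ⊢
      exact S.monoD h hp
    · intro p
      obtain ⟨k, hk⟩ := S.complete p.1 p.2
      exact ⟨k, Finset.mem_subtype.mpr hk⟩
  refine (hs.comp h1).congr (fun k => ?_)
  rw [S.Z_eq]
  exact Finset.sum_subtype_of_mem (boltzmann T) (S.domD k)

theorem Z_le_Zfun (hT : 0 < T) (hT1 : T ≤ 1) (k : ℕ) : S.Z k ≤ Zfun V T :=
  S.monoZ.ge_of_tendsto (S.tendsto_Z hT hT1) k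

theorem Zfun_le (S : Setup V T) (hT : 0 < T) (hT1 : T ≤ 1) : Zfun V T ≤ 1 :=
  le_of_tendsto' (S.tendsto_Z hT hT1) S.Z_le

theorem antiF (hT : 0 < T) : Antitone S.F := by
  intro k k' h
  rw [S.F_eq, S.F_eq]
  have := Real.logb_le_logb_of_le (b := 2) (by norm_num) (S.Z_pos k) (S.monoZ h)
  nlinarith

theorem tendsto_F (hT : 0 < T) (hT1 : T ≤ 1) : Tendsto S.F atTop (𝓝 (Ffun V T)) := by
  have h : Tendsto (fun k => -T * Real.logb 2 (S.Z k)) atTop (𝓝 (Ffun V T)) := by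
    refine Tendsto.const_mul (-T) ?_
    exact ((Real.continuousAt_logb (Zfun_pos V hT hT1).ne').tendsto).comp (S.tendsto_Z hT hT1)
  exact h.congr (fun k => (S.F_eq k).symm)

theorem Ffun_le (hT : 0 < T) (hT1 : T ≤ 1) (k : ℕ) : Ffun V T ≤ S.F k :=
  (S.antiF hT).le_of_tendsto (S.tendsto_F hT hT1) k

theorem Ffun_nonneg (S : Setup V T) (hT : 0 < T) (hT1 : T ≤ 1) : 0 ≤ Ffun V T := by
  have : Real.logb 2 (Zfun V T) ≤ 0 :=
    Real.logb_nonpos (by norm_num) (Zfun_pos V hT hT1).le (S.Zfun_le hT hT1)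
  unfold Ffun
  nlinarith

theorem boltzmann_le_sub (hT : 0 < T) (hT1 : T ≤ 1) {q : List Bool} (hq : q ∈ V.f.Dom) {k : ℕ}
    (hk : q ∉ S.D k) : boltzmann T q ≤ Zfun V T - S.Z k := by
  obtain ⟨k', hk'⟩ := S.complete q hq
  have h1 := S.Z_le_Zfun hT hT1 (max k k')
  have h2 : S.Z k + boltzmann T q ≤ S.Z (max k k') := by
    rw [S.Z_eq, S.Z_eq, add_comm, ← Finset.sum_insert hk]
    refine Finset.sum_le_sum_of_subset_of_nonneg ?_ (fun p _ _ => (boltzmann_pos T p).le)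
    intro p hp
    rcases Finset.mem_insert.mp hp with rfl | hp
    · exact S.monoD (le_max_right _ _) hk'
    · exact S.monoD (le_max_left _ _) hp
  linarith

theorem Z_exp (hT : 0 < T) (k : ℕ) : S.Z k = Real.exp (-(S.F k * Real.log 2 / T)) := by
  have : -(S.F k * Real.log 2 / T) = Real.log (S.Z k) := by
    rw [S.F_eq, Real.logb]
    have : Real.log 2 ≠ 0 := (Real.log_pos (by norm_num)).ne'
    field_simp
  rw [this, Real.exp_log (S.Z_pos k)]

theorem Zfun_exp (hT : 0 < T) (hT1 : T ≤ 1) :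
    Zfun V T = Real.exp (-(Ffun V T * Real.log 2 / T)) := by
  have : -(Ffun V T * Real.log 2 / T) = Real.log (Zfun V T) := by
    rw [Ffun, Real.logb]
    have : Real.log 2 ≠ 0 := (Real.log_pos (by norm_num)).ne'
    field_simp
  rw [this, Real.exp_log (Zfun_pos V hT hT1)]

theorem sub_le (hT : 0 < T) (hT1 : T ≤ 1) (k : ℕ) :
    Zfun V T - S.Z k ≤ (S.F k - Ffun V T) / T := by
  have hl : Real.log 2 ≤ 1 := by linarith [Real.log_two_lt_d9]
  have hl0 : 0 < Real.log 2 := Real.log_pos (by norm_num)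
  set x := (S.F k - Ffun V T) / T with hx
  have hx0 : 0 ≤ x := div_nonneg (by linarith [S.Ffun_le hT hT1 k]) hT.le
  have e : S.Z k = Zfun V T * Real.exp (-(x * Real.log 2)) := by
    rw [S.Z_exp hT, Zfun_exp hT hT1, ← Real.exp_add]
    congr 1
    rw [hx]; ring
  have h1 : 1 - x * Real.log 2 ≤ Real.exp (-(x * Real.log 2)) := by
    have := Real.add_one_le_exp (-(x * Real.log 2)); linarith
  have hZ := S.Zfun_le hT hT1
  have hZ0 := Zfun_pos V hT hT1
  rw [e]
  have h2 : x * Real.log 2 ≤ x := by nlinarith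
  have h3 : 0 ≤ x * Real.log 2 := by positivity
  nlinarith

theorem le_sub (hT : 0 < T) (k k' : ℕ) (h : S.F k' ≤ S.F k) :
    S.Z 0 * ((S.F k - S.F k') / (2 * T)) ≤ S.Z k' - S.Z k := by
  have hl : 1 / 2 ≤ Real.log 2 := by linarith [Real.log_two_gt_d9]
  set x := (S.F k - S.F k') / T with hx
  have hx0 : 0 ≤ x := div_nonneg (by linarith) hT.le
  have e : S.Z k' = S.Z k * Real.exp (x * Real.log 2) := by
    rw [S.Z_exp hT, S.Z_exp hT, ← Real.exp_add]
    congr 1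
    rw [hx]; ring
  have h1 : 1 + x * Real.log 2 ≤ Real.exp (x * Real.log 2) := by
    have := Real.add_one_le_exp (x * Real.log 2); linarith
  have h0 := S.monoZ (Nat.zero_le k)
  have hp := S.Z_pos 0
  have h2 : x / 2 ≤ Real.exp (x * Real.log 2) - 1 := by nlinarith
  rw [show (S.F k - S.F k') / (2 * T) = x / 2 by rw [hx]; field_simp, e]
  calc S.Z 0 * (x / 2) ≤ S.Z k * (x / 2) := by
        apply mul_le_mul_of_nonneg_right h0 (by positivity)
    _ ≤ S.Z k * (Real.exp (x * Real.log 2) - 1) :=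
        mul_le_mul_of_nonneg_left h2 (S.Z_pos k).le
    _ = _ := by ring

end Setup


open Filter Topology

/-! ### Bits -/

def bval (l : List Bool) : ℕ := l.foldl (fun a b => 2 * a + b.toNat) 0

theorem bval_append (l : List Bool) (b : Bool) : bval (l ++ [b]) = 2 * bval l + b.toNat := by
  simp [bval]

theorem computable_bval : Computable bval := by
  have h : Primrec (fun b : Bool => b.toNat) := Primrec.dom_bool _
  have : Primrec bval :=
    Primrec.list_foldl (f := fun l : List Bool => l) (g := fun _ => 0)
      (h := fun _ p => 2 * p.1 + p.2.toNat) Primrec.id (Primrec.const 0)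
      (Primrec.nat_add.comp (Primrec.nat_mul.comp (Primrec.const 2)
        (Primrec.fst.comp Primrec.snd)) (h.comp (Primrec.snd.comp Primrec.snd)))
  exact this.to_comp

theorem exists_bval (L : ℕ) : ∀ N < 2 ^ L, ∃ r : List Bool, r.length = L ∧ bval r = N := by
  induction L with
  | zero =>
    intro N hN
    exact ⟨[], rfl, by simp at hN; simp [bval, hN]⟩
  | succ L ih =>
    intro N hN
    obtain ⟨r, hr, hrN⟩ := ih (N / 2) (by rw [pow_succ] at hN; omega)
    refine ⟨r ++ [decide (N % 2 = 1)], by simp [hr], ?_⟩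
    rw [bval_append, hrN]
    rcases Nat.mod_two_eq_zero_or_one N with h | h <;> simp [h] <;> omega

def bitsOf (n A : ℕ) : List Bool := (List.range n).map (fun i => decide (A / 2 ^ (n - 1 - i) % 2 = 1))

theorem computable_bitsOf : Computable₂ bitsOf := by
  have : Primrec₂ bitsOf := by
    refine Primrec.list_map (f := fun z : ℕ × ℕ => List.range z.1)
      (g := fun z i => decide (z.2 / 2 ^ (z.1 - 1 - i) % 2 = 1))
      (Primrec.list_range.comp Primrec.fst) ?_
    have h : PrimrecPred (fun q : (ℕ × ℕ) × ℕ => q.1.2 / 2 ^ (q.1.1 - 1 - q.2) % 2 = 1) := by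
      refine Primrec.eq.comp (Primrec.nat_mod.comp (Primrec.nat_div.comp
        (Primrec.snd.comp Primrec.fst) (primrec_pow.comp (Primrec.const 2)
        (Primrec.nat_sub.comp (Primrec.nat_sub.comp (Primrec.fst.comp Primrec.fst)
          (Primrec.const 1)) Primrec.snd))) (Primrec.const 2)) (Primrec.const 1)
    exact h.decide
  exact this.to_comp

theorem floor_scale (F : ℝ) {n m : ℕ} (h : n ≤ m) :
    ⌊2 ^ n * F⌋₊ = ⌊2 ^ m * F⌋₊ / 2 ^ (m - n) := by
  rw [← Nat.floor_div_natCast]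
  congr 1
  obtain ⟨j, rfl⟩ := Nat.exists_eq_add_of_le h
  rw [Nat.add_sub_cancel_left, pow_add]
  push_cast
  field_simp

theorem bitOf_eq {F : ℝ} (hF : 0 ≤ F) (i : ℕ) :
    bitOf F i = decide (⌊2 ^ (i + 1) * F⌋₊ % 2 = 1) := by
  unfold bitOf
  congr 1
  have h1 : (F - ⌊F⌋) * 2 ^ (i + 1) = 2 ^ (i + 1) * F - ((⌊F⌋ * 2 ^ (i + 1) : ℤ) : ℝ) := by
    push_cast; ring
  rw [h1, Int.floor_sub_intCast]
  have h2 : ((⌊2 ^ (i + 1) * F⌋₊ : ℕ) : ℤ) = ⌊2 ^ (i + 1) * F⌋ :=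
    Int.natCast_floor_eq_floor (by positivity)
  rw [← h2]
  apply propext
  have : ⌊F⌋ * 2 ^ (i + 1) = 2 * (⌊F⌋ * 2 ^ i) := by ring
  rw [this]
  omega

theorem firstBits_eq {F : ℝ} (hF : 0 ≤ F) (n : ℕ) : firstBits F n = bitsOf n ⌊2 ^ n * F⌋₊ := by
  unfold firstBits bitsOf
  apply List.map_congr_left
  intro i hi
  rw [List.mem_range] at hi
  rw [bitOf_eq hF, floor_scale F (show i + 1 ≤ n by omega), show n - (i + 1) = n - 1 - i by omega]

theorem bval_firstBits {F : ℝ} (hF : 0 ≤ F) (n : ℕ) :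
    ⌊F⌋₊ * 2 ^ n + bval (firstBits F n) = ⌊2 ^ n * F⌋₊ := by
  induction n with
  | zero => simp [firstBits, bval]
  | succ n ih =>
    have : firstBits F (n + 1) = firstBits F n ++ [bitOf F n] := by
      simp [firstBits, List.range_succ]
    rw [this, bval_append, bitOf_eq hF]
    have h2 := floor_scale F (Nat.le_succ n)
    rw [Nat.succ_sub (le_refl n), Nat.sub_self, Nat.succ_eq_add_one, Nat.succ_eq_add_one,
      zero_add, pow_one] at h2
    rw [h2] at ih
    rw [pow_succ]
    rcases Nat.mod_two_eq_zero_or_one ⌊2 ^ (n + 1) * F⌋₊ with h | h <;>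
      simp only [h, decide_true, Bool.toNat_true, Nat.zero_ne_one, decide_false,
        Bool.toNat_false] <;> nlinarith [Nat.div_add_mod ⌊2 ^ (n + 1) * F⌋₊ 2]

theorem length_firstBits (F : ℝ) (n : ℕ) : (firstBits F n).length = n := by simp [firstBits]

/-! ### Complexity -/

/-- An optimal computer produces every string. -/
theorem Optimal.surj {U : Computer} (hU : Optimal U) (s : List Bool) : ∃ p, s ∈ U.f p := by
  have hp : Partrec (fun p : List Bool => (if p = [] then Part.some s else Part.none)) := by
    have h : Partrec (fun p : List Bool =>
        ((if p = [] then some s else none : Option (List Bool)) : Part (List Bool))) := by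
      apply Computable.ofOption
      exact (Primrec.ite (Primrec.eq.comp Primrec.id (Primrec.const [])) (Primrec.const _)
        (Primrec.const _)).to_comp
    refine h.of_eq (fun p => ?_)
    split_ifs <;> simp
  have hd : ∀ p, p ∈ PFun.Dom (fun p : List Bool => (if p = [] then Part.some s else Part.none))
      → p = [] := by
    intro p hp
    obtain ⟨y, hy⟩ := (PFun.mem_dom _ _).mp hp
    by_contra hne
    simp [hne] at hy
  have hd0 : [] ∈ PFun.Dom (fun p : List Bool => (if p = [] then Part.some s else Part.none)) :=
    (PFun.mem_dom _ _).mpr ⟨s, by simp⟩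
  obtain ⟨d, h⟩ := hU ⟨_, hp, ⟨[], hd0⟩, fun p hp q hq _ => by rw [hd p hp, hd q hq]⟩
  obtain ⟨q, hq, _⟩ := h [] hd0
  exact ⟨q, by rw [hq]; simp⟩

theorem Optimal.exists_min {U : Computer} (hU : Optimal U) (s : List Bool) :
    ∃ p, s ∈ U.f p ∧ p.length = complexity U s := by
  have : {n | ∃ p : List Bool, s ∈ U.f p ∧ p.length = n}.Nonempty := by
    obtain ⟨p, hp⟩ := hU.surj s
    exact ⟨_, p, hp, rfl⟩
  exact Nat.sInf_mem this

theorem Optimal.complexity_le {U : Computer} (hU : Optimal U) (C : Computer) :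
    ∃ d : ℕ, ∀ p s, s ∈ C.f p → complexity U s ≤ p.length + d := by
  obtain ⟨d, h⟩ := hU C
  refine ⟨d, fun p s hs => ?_⟩
  obtain ⟨q, hq, hl⟩ := h p ((PFun.mem_dom _ _).mpr ⟨s, hs⟩)
  exact (Nat.sInf_le (show q.length ∈ {n | ∃ p : List Bool, s ∈ U.f p ∧ p.length = n} from
    ⟨q, hq ▸ hs, rfl⟩)).trans hl


open Filter Topology

/-! ### Weak Chaitin randomness -/

namespace Setup

variable {V : Computer} {T : ℝ} (S : Setup V T)

def total (k : ℕ) : ℕ := listSum ((S.St k).map (fun x => x.2.length))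

def longOut (k : ℕ) : List Bool := (List.range (S.total k + 1)).map (fun _ => true)

theorem length_longOut (k : ℕ) : (S.longOut k).length = S.total k + 1 := by simp [longOut]

theorem computable_longOut : Computable S.longOut := by
  have h : Primrec (fun l : List (List Bool × List Bool) => l.map (fun x => x.2.length)) :=
    Primrec.list_map Primrec.id (Primrec.list_length.comp (Primrec.snd.comp Primrec.snd))
  have h1 : Computable S.total := primrec_listSum.to_comp.comp (h.to_comp.comp S.compSt)
  have h2 : Primrec (fun n : ℕ => (List.range (n + 1)).map (fun _ => true)) :=
    Primrec.list_map (Primrec.list_range.comp Primrec.succ) (Primrec.const true)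
  exact h2.to_comp.comp h1

theorem longOut_not_mem {k : ℕ} {q : List Bool} (hq : q ∈ S.D k) : S.longOut k ∉ V.f q := by
  intro h
  obtain ⟨s, hs⟩ := (S.memD k q).mp hq
  have h2 := Part.mem_unique h (S.sound k q s hs)
  have h3 : s.length ≤ S.total k := le_listSum (List.mem_map.mpr ⟨_, hs, rfl⟩)
  have := S.length_longOut k
  rw [h2] at this
  omega

theorem eventually_G (hT : 0 < T) (hT1 : T ≤ 1) (n : ℕ) :
    ∀ᶠ k in atTop, S.G n k ≤ ⌊2 ^ n * Ffun V T⌋₊ + 1 := by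
  have h1 : 2 ^ n * Ffun V T < ⌊2 ^ n * Ffun V T⌋₊ + 1 := Nat.lt_floor_add_one _
  have h2 : Tendsto (fun k => 2 ^ n * S.F k) atTop (𝓝 (2 ^ n * Ffun V T)) :=
    (S.tendsto_F hT hT1).const_mul _
  filter_upwards [h2.eventually_lt_const h1] with k hk
  have := S.G_lt n k
  have h3 : (S.G n k : ℝ) < ((⌊2 ^ n * Ffun V T⌋₊ + 2 : ℕ) : ℝ) := by push_cast; linarith
  have := Nat.cast_lt.mp h3
  omega

theorem weaklyRandom (S : Setup V T) {U : Computer} (hU : Optimal U) (hV : Optimal V) (hT : 0 < T)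
    (hT1 : T ≤ 1) : WeaklyChaitinTRandom U T (Ffun V T) := by
  set F := Ffun V T with hFdef
  have hF : 0 ≤ F := S.Ffun_nonneg hT hT1
  set K := ⌊F⌋₊ with hK
  let P : List Bool → ℕ → Bool := fun s k =>
    decide (S.G s.length k < K * 2 ^ s.length + bval s + 2)
  have hlen : Computable (fun z : List Bool × ℕ => z.1.length) :=
    Computable.list_length.comp Computable.fst
  have hP : Computable₂ P :=
    computable_lt (f := fun z : List Bool × ℕ => S.G z.1.length z.2)
      (g := fun z => K * 2 ^ z.1.length + bval z.1 + 2)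
      (S.compG.comp hlen Computable.snd)
      (computable_add (computable_add (computable_mul (Computable.const K)
        (computable_pow (Computable.const 2) hlen)) (computable_bval.comp Computable.fst))
        (Computable.const 2))
  let φ : List Bool →. List Bool := fun s =>
    (Nat.rfind (fun k => Part.some (P s k))).map (fun k => S.longOut k)
  have hφ : Partrec φ :=
    (partrec_search hP).map (S.computable_longOut.comp Computable.snd)
  have hPiff : ∀ n k, P (firstBits F n) k = true ↔ S.G n k < ⌊2 ^ n * F⌋₊ + 2 := by
    intro n k
    simp only [P, decide_eq_true_iff, length_firstBits]
    have hb := bval_firstBits hF n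
    rw [← hK] at hb
    rw [hb]
  have hmain : ∀ n, ∃ k, S.longOut k ∈ φ (firstBits F n) ∧ 2 ^ n * S.F k < 2 ^ n * F + 2 := by
    intro n
    have hex : ∃ k, P (firstBits F n) k = true := by
      obtain ⟨k, hk⟩ := (S.eventually_G hT hT1 n).exists
      rw [← hFdef] at hk
      exact ⟨k, (hPiff n k).mpr (by omega)⟩
    refine ⟨Nat.find hex, ?_, ?_⟩
    · refine (Part.mem_map_iff _).mpr ⟨Nat.find hex, ?_, rfl⟩
      rw [mem_rfind_some]
      refine ⟨Nat.find_spec hex, fun m hm => ?_⟩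
      simpa using Nat.find_min hex hm
    · have h := (hPiff n _).mp (Nat.find_spec hex)
      have h1 := S.lt_G n (Nat.find hex)
      have h2 : (S.G n (Nat.find hex) : ℝ) + 1 ≤ ⌊2 ^ n * F⌋₊ + 2 := by exact_mod_cast h
      have h3 : (⌊2 ^ n * F⌋₊ : ℝ) ≤ 2 ^ n * F := Nat.floor_le (by positivity)
      linarith
  have hdom : ∀ p, p ∈ PFun.Dom (fun p => (U.f p).bind φ) → p ∈ U.f.Dom := by
    intro p hp
    obtain ⟨y, hy⟩ := (PFun.mem_dom _ _).mp hp
    obtain ⟨s, hs, _⟩ := Part.mem_bind_iff.mp hy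
    exact (PFun.mem_dom _ _).mpr ⟨s, hs⟩
  have hmem : ∀ p n k, firstBits F n ∈ U.f p → S.longOut k ∈ φ (firstBits F n) →
      S.longOut k ∈ (U.f p).bind φ := fun p n k h1 h2 =>
    Part.mem_bind_iff.mpr ⟨_, h1, h2⟩
  let C : Computer :=
    { f := fun p => (U.f p).bind φ
      partrec := U.partrec.bind (hφ.comp Computable.snd)
      dom_nonempty := by
        obtain ⟨k, hk, _⟩ := hmain 0
        obtain ⟨p, hp⟩ := hU.surj (firstBits F 0)
        exact ⟨p, (PFun.mem_dom _ _).mpr ⟨_, hmem p 0 k hp hk⟩⟩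
      dom_prefixFree := fun p hp q hq => U.dom_prefixFree p (hdom p hp) q (hdom q hq) }
  obtain ⟨d, hd⟩ := hV C
  refine ⟨⌈T * (1 - Real.logb 2 T)⌉₊ + d, fun n _ => ?_⟩
  obtain ⟨k, hk, hkF⟩ := hmain n
  obtain ⟨p, hp, hpl⟩ := hU.exists_min (firstBits F n)
  have hCp : S.longOut k ∈ C.f p := hmem p n k hp hk
  obtain ⟨q, hq, hql⟩ := hd p ((PFun.mem_dom _ _).mpr ⟨_, hCp⟩)
  rw [← hq] at hCp
  have hqD : q ∉ S.D k := fun h => S.longOut_not_mem h hCp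
  have h1 := S.boltzmann_le_sub hT hT1 ((PFun.mem_dom _ _).mpr ⟨_, hCp⟩) hqD
  have h2 := S.sub_le hT hT1 k
  have h3 : (S.F k - F) / T ≤ (2 : ℝ) ^ (1 - (n : ℝ) - Real.logb 2 T) := by
    rw [Real.rpow_sub (by norm_num), Real.rpow_logb (by norm_num) (by norm_num) hT,
      Real.rpow_sub (by norm_num), Real.rpow_one, Real.rpow_natCast,
      div_le_div_iff_of_pos_right hT, le_div_iff₀ (by positivity)]
    linarith
  have h4 : (2 : ℝ) ^ (-(q.length : ℝ) / T) ≤ (2 : ℝ) ^ (1 - (n : ℝ) - Real.logb 2 T) :=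
    h1.trans (h2.trans h3)
  rw [Real.rpow_le_rpow_left_iff (by norm_num), div_le_iff₀ hT] at h4
  have h5 : T * (1 - Real.logb 2 T) ≤ ⌈T * (1 - Real.logb 2 T)⌉₊ := Nat.le_ceil _
  have h6 : (q.length : ℝ) ≤ complexity U (firstBits F n) + d := by
    rw [← hpl]; exact_mod_cast hql
  push_cast
  nlinarith

end Setup


open Filter Topology

/-! ### Building computers from prefix codes -/

theorem exists_computer {α : Type} [Primcodable α] {E : α → List Bool} (hE : Computable E)
    (hpf : ∀ x y, E x <+: E y → x = y) {g : α →. List Bool} (hg : Partrec g)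
    (hne : ∃ x s, s ∈ g x) : ∃ C : Computer, ∀ x s, s ∈ g x → s ∈ C.f (E x) := by
  let P : List Bool → ℕ → Bool := fun p x =>
    decide (((Encodable.decode (α := α) x).map E) = some p)
  have hP : Computable₂ P := by
    have h1 : Computable (fun z : List Bool × ℕ => (Encodable.decode (α := α) z.2).map E) :=
      Computable.option_map (Computable.decode.comp Computable.snd) (hE.comp Computable.snd)
    have h2 : Computable (fun z : List Bool × ℕ => some z.1) :=
      Computable.option_some.comp Computable.fst
    exact (Primrec.eq.decide).to_comp.comp h1 h2
  let f : List Bool →. List Bool := fun p =>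
    (Nat.rfind (fun x => Part.some (P p x))).bind (fun x =>
      ((Encodable.decode (α := α) x : Option α) : Part α).bind g)
  have hf : Partrec f := by
    refine (partrec_search hP).bind ?_
    have h1 : Partrec (fun z : List Bool × ℕ =>
        ((Encodable.decode (α := α) z.2 : Option α) : Part α)) :=
      Computable.ofOption (Computable.decode.comp Computable.snd)
    exact h1.bind (hg.comp Computable.snd)
  have hmem : ∀ x s, s ∈ g x → s ∈ f (E x) := by
    intro x s hs
    have hex : ∃ m, P (E x) m = true := ⟨Encodable.encode x, by simp [P]⟩
    refine Part.mem_bind_iff.mpr ⟨Nat.find hex, ?_, ?_⟩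
    · rw [mem_rfind_some]
      refine ⟨Nat.find_spec hex, fun m hm => ?_⟩
      simpa using Nat.find_min hex hm
    · have h : ((Encodable.decode (α := α) (Nat.find hex)).map E) = some (E x) :=
        of_decide_eq_true (Nat.find_spec hex)
      obtain ⟨y, hy, hyx⟩ := Option.map_eq_some_iff.mp h
      have hxy : y = x := hpf y x (by rw [hyx])
      rw [hy, hxy]
      exact Part.mem_bind_iff.mpr ⟨x, by simp, hs⟩
  have hdom : ∀ p ∈ f.Dom, ∃ x, p = E x := by
    intro p hp
    obtain ⟨s, hs⟩ := (PFun.mem_dom _ _).mp hp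
    obtain ⟨m, hm, _⟩ := Part.mem_bind_iff.mp hs
    rw [mem_rfind_some] at hm
    have h : ((Encodable.decode (α := α) m).map E) = some p := of_decide_eq_true hm.1
    obtain ⟨y, hy, hyx⟩ := Option.map_eq_some_iff.mp h
    exact ⟨y, hyx.symm⟩
  refine ⟨{ f := f, partrec := hf, dom_nonempty := ?_, dom_prefixFree := ?_ }, hmem⟩
  · obtain ⟨x, s, h⟩ := hne
    exact ⟨E x, (PFun.mem_dom _ _).mpr ⟨s, hmem x s h⟩⟩
  · intro p hp q hq hpq
    obtain ⟨x, rfl⟩ := hdom p hp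
    obtain ⟨y, rfl⟩ := hdom q hq
    rw [hpf x y hpq]

def unary (a : ℕ) : List Bool := (List.range a).map (fun _ => false) ++ [true]

theorem unary_zero : unary 0 = [true] := rfl

theorem unary_succ (a : ℕ) : unary (a + 1) = false :: unary a := by
  simp only [unary, List.range_succ_eq_map, List.map_cons, List.map_map, List.cons_append]
  rfl

theorem unary_pfx_inj {a b : ℕ} {s t : List Bool} (h : unary a ++ s <+: unary b ++ t) :
    a = b ∧ s <+: t := by
  induction a generalizing b with
  | zero =>
    cases b with
    | zero => simpa [unary_zero] using h
    | succ b => simp [unary_zero, unary_succ] at h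
  | succ a ih =>
    cases b with
    | zero => simp [unary_zero, unary_succ] at h
    | succ b =>
      simp only [unary_succ, List.cons_append, List.cons_prefix_cons, true_and] at h
      obtain ⟨h1, h2⟩ := ih h
      exact ⟨by rw [h1], h2⟩

theorem length_unary (a : ℕ) : (unary a).length = a + 1 := by simp [unary]

theorem computable_unary : Computable unary := by
  have : Primrec unary :=
    Primrec.list_append.comp (Primrec.list_map Primrec.list_range (Primrec.const false))
      (Primrec.const [true])
  exact this.to_comp

/-- A self-delimiting code for `n` of length `O(√n)`. -/
def ncode (n : ℕ) : List Bool := unary n.unpair.1 ++ unary n.unpair.2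

theorem computable_ncode : Computable ncode :=
  Computable.list_append.comp (computable_unary.comp (Computable.fst.comp Computable.unpair))
    (computable_unary.comp (Computable.snd.comp Computable.unpair))

theorem ncode_pfx_inj {a b : ℕ} {s t : List Bool} (h : ncode a ++ s <+: ncode b ++ t) :
    a = b ∧ s <+: t := by
  simp only [ncode, List.append_assoc] at h
  obtain ⟨h1, h2⟩ := unary_pfx_inj h
  obtain ⟨h3, h4⟩ := unary_pfx_inj h2
  refine ⟨?_, h4⟩
  rw [← Nat.pair_unpair a, ← Nat.pair_unpair b, h1, h3]

theorem length_ncode (n : ℕ) : (ncode n).length ≤ 2 * Nat.sqrt n + 2 := by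
  simp only [ncode, List.length_append, length_unary]
  have h1 := Nat.sqrt_le_add n
  simp only [Nat.unpair]
  split_ifs with h
  · dsimp only; omega
  · dsimp only; omega

def pcode (x : (ℕ × ℕ) × List Bool) : List Bool :=
  ncode x.1.1 ++ (ncode x.2.length ++ (unary x.1.2 ++ x.2))

theorem computable_pcode : Computable pcode := by
  refine Computable.list_append.comp (computable_ncode.comp (Computable.fst.comp Computable.fst))
    (Computable.list_append.comp (computable_ncode.comp (Computable.list_length.comp
      Computable.snd)) (Computable.list_append.comp
        (computable_unary.comp (Computable.snd.comp Computable.fst)) Computable.snd))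

theorem pcode_pfx_inj (x y : (ℕ × ℕ) × List Bool) (h : pcode x <+: pcode y) : x = y := by
  obtain ⟨⟨n, e⟩, r⟩ := x
  obtain ⟨⟨n', e'⟩, r'⟩ := y
  obtain ⟨h1, h2⟩ := ncode_pfx_inj h
  obtain ⟨h3, h4⟩ := ncode_pfx_inj h2
  obtain ⟨h5, h6⟩ := unary_pfx_inj h4
  dsimp only at h1 h3 h5 h6
  rw [h1, h5, h6.eq_of_length h3]

/-! ### Subadditivity -/

theorem rpow_sum_le {ι : Type*} (s : Finset ι) (f : ι → ℝ) (hf : ∀ i ∈ s, 0 ≤ f i) {T : ℝ}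
    (hT : 0 < T) (hT1 : T ≤ 1) : (∑ i ∈ s, f i) ^ T ≤ ∑ i ∈ s, f i ^ T := by
  classical
  induction s using Finset.induction_on with
  | empty => simp [Real.zero_rpow hT.ne']
  | insert a s ha ih =>
    rw [Finset.sum_insert ha, Finset.sum_insert ha]
    have h1 := hf a (Finset.mem_insert_self _ _)
    have h2 : ∀ i ∈ s, 0 ≤ f i := fun i hi => hf i (Finset.mem_insert_of_mem hi)
    exact (Real.rpow_add_le_add_rpow h1 (Finset.sum_nonneg h2) hT.le hT1).trans
      (by linarith [ih h2])


open Filter Topology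

/-! ### Compressibility -/

namespace Setup

variable {V : Computer} {T : ℝ} (S : Setup V T)

def st (S : Setup V T) (n : ℕ) : ℕ → ℕ × ℕ
  | 0 => (0, S.G n 0)
  | k + 1 => bif decide (S.G n (k + 1) + 4 < (st S n k).2 + 1) then
      ((st S n k).1 + 1, S.G n (k + 1)) else st S n k

theorem computable_st : Computable₂ S.st := by
  have hG0 : Computable (fun z : ℕ × ℕ => ((0, S.G z.1 0) : ℕ × ℕ)) :=
    (Computable.const 0).pair (S.compG.comp Computable.fst (Computable.const 0))
  have hk : Computable (fun q : (ℕ × ℕ) × ℕ × ℕ × ℕ => S.G q.1.1 (q.2.1 + 1)) :=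
    S.compG.comp (Computable.fst.comp Computable.fst)
      (Computable.succ.comp (Computable.fst.comp Computable.snd))
  have hprev : Computable (fun q : (ℕ × ℕ) × ℕ × ℕ × ℕ => q.2.2) :=
    Computable.snd.comp Computable.snd
  have hstep : Computable (fun q : (ℕ × ℕ) × ℕ × ℕ × ℕ =>
      bif decide (S.G q.1.1 (q.2.1 + 1) + 4 < q.2.2.2 + 1) then
        (q.2.2.1 + 1, S.G q.1.1 (q.2.1 + 1)) else q.2.2) :=
    Computable.cond (computable_lt (computable_add hk (Computable.const 4))
      (Computable.succ.comp (Computable.snd.comp hprev)))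
      ((Computable.succ.comp (Computable.fst.comp hprev)).pair hk) hprev
  refine (Computable.nat_rec (f := fun z : ℕ × ℕ => z.2) (g := fun z => ((0, S.G z.1 0) : ℕ × ℕ))
    (h := fun z q => bif decide (S.G z.1 (q.1 + 1) + 4 < q.2.2 + 1) then
        (q.2.1 + 1, S.G z.1 (q.1 + 1)) else q.2) Computable.snd hG0 hstep).of_eq ?_
  rintro ⟨n, k⟩
  induction k with
  | zero => rfl
  | succ k ih =>
    dsimp only at ih ⊢
    rw [ih]
    rfl

theorem st_succ (n k : ℕ) :
    (S.G n (k + 1) + 4 ≤ (S.st n k).2 ∧ S.st n (k + 1) = ((S.st n k).1 + 1, S.G n (k + 1))) ∨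
    ((S.st n k).2 < S.G n (k + 1) + 4 ∧ S.st n (k + 1) = S.st n k) := by
  by_cases h : S.G n (k + 1) + 4 < (S.st n k).2 + 1
  · left
    refine ⟨by omega, ?_⟩
    simp [st, h]
  · right
    refine ⟨by omega, ?_⟩
    simp [st, h]

noncomputable def Om (k : ℕ) : ℝ := ∑ p ∈ S.D k, ((1 : ℝ) / 2) ^ p.length

theorem Om_sub (hT : 0 < T) (hT1 : T ≤ 1) {j k : ℕ} (h : j ≤ k) :
    (S.Z k - S.Z j) ^ T ≤ S.Om k - S.Om j := by
  have h1 : S.Om k - S.Om j = ∑ p ∈ S.D k \ S.D j, ((1 : ℝ) / 2) ^ p.length := by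
    rw [Om, Om, ← Finset.sum_sdiff (S.monoD h)]; ring
  have h2 : S.Z k - S.Z j = ∑ p ∈ S.D k \ S.D j, boltzmann T p := by
    rw [S.Z_eq, S.Z_eq, ← Finset.sum_sdiff (S.monoD h)]; ring
  rw [h1, h2]
  refine (rpow_sum_le _ _ (fun p _ => (boltzmann_pos T p).le) hT hT1).trans (le_of_eq ?_)
  exact Finset.sum_congr rfl (fun p _ => boltzmann_rpow hT p)

theorem Om_mono : Monotone S.Om := by
  intro j k h
  exact Finset.sum_le_sum_of_subset_of_nonneg (S.monoD h) (fun p _ _ => by positivity)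

theorem Om_le (k : ℕ) : S.Om k ≤ 1 := kraft_dom V (S.domD k)

theorem Om_nonneg (k : ℕ) : 0 ≤ S.Om k := Finset.sum_nonneg (fun p _ => by positivity)

noncomputable def delta (n : ℕ) : ℝ := (S.Z 0 / T * (2 ^ n)⁻¹) ^ T

theorem step_ge (hT : 0 < T) (hT1 : T ≤ 1) {n j k : ℕ} (h : j ≤ k)
    (hG : S.G n k + 4 ≤ S.G n j) : S.delta n ≤ S.Om k - S.Om j := by
  refine le_trans ?_ (S.Om_sub hT hT1 h)
  have h1 := S.lt_G n k
  have h2 := S.G_lt n j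
  have h3 : (S.G n k : ℝ) + 4 ≤ S.G n j := by exact_mod_cast hG
  have h4 : 2 * ((2 : ℝ) ^ n)⁻¹ ≤ S.F j - S.F k := by
    rw [← div_eq_mul_inv, div_le_iff₀ (by positivity)]
    linarith
  have h5 := S.le_sub hT j k (S.antiF hT h)
  have hZ := S.Z_pos 0
  have h6 : S.Z 0 / T * ((2 : ℝ) ^ n)⁻¹ ≤ S.Z 0 * ((S.F j - S.F k) / (2 * T)) := by
    rw [← mul_div_assoc, le_div_iff₀ (by positivity)]
    have : S.Z 0 / T * ((2 : ℝ) ^ n)⁻¹ * (2 * T) = S.Z 0 * (2 * ((2 : ℝ) ^ n)⁻¹) := by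
      field_simp
    rw [this]
    exact mul_le_mul_of_nonneg_left h4 hZ.le
  exact Real.rpow_le_rpow (by positivity) (h6.trans h5) hT.le

theorem st_inv (hT : 0 < T) (hT1 : T ≤ 1) (n k : ℕ) :
    ∃ j ≤ k, (S.st n k).2 = S.G n j ∧ (S.st n k).1 * S.delta n ≤ S.Om j := by
  induction k with
  | zero => exact ⟨0, le_refl _, rfl, by simpa [st] using S.Om_nonneg 0⟩
  | succ k ih =>
    obtain ⟨j, hj, h1, h2⟩ := ih
    rcases S.st_succ n k with ⟨h3, h4⟩ | ⟨_, h4⟩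
    · refine ⟨k + 1, le_refl _, by rw [h4], ?_⟩
      rw [h4]
      have := S.step_ge hT hT1 (n := n) (show j ≤ k + 1 by omega) (by rw [← h1]; exact h3)
      push_cast
      linarith
    · exact ⟨j, by omega, by rw [h4]; exact h1, by rw [h4]; exact h2⟩

theorem count_mono (n : ℕ) : Monotone (fun k => (S.st n k).1) := by
  apply monotone_nat_of_le_succ
  intro k
  rcases S.st_succ n k with ⟨_, h4⟩ | ⟨_, h4⟩
  · rw [h4]; simp
  · rw [h4]

theorem exists_c1 (hT : 0 < T) (hT1 : T ≤ 1) :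
    ∃ c : ℕ, ∀ n k, (S.st n k).1 < 2 ^ (⌈T * n⌉₊ + c) := by
  have hZ := S.Z_pos 0
  obtain ⟨c, hc⟩ := pow_unbounded_of_one_lt (((S.Z 0 / T) ^ T)⁻¹) (show (1 : ℝ) < 2 by norm_num)
  have hp : 0 < (S.Z 0 / T) ^ T := by positivity
  refine ⟨c, fun n k => ?_⟩
  obtain ⟨j, _, _, h⟩ := S.st_inv hT hT1 n k
  have h1 := h.trans (S.Om_le j)
  have hd : S.delta n = (S.Z 0 / T) ^ T * ((2 : ℝ) ^ (T * n))⁻¹ := by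
    rw [delta, Real.mul_rpow (by positivity) (by positivity), Real.inv_rpow (by positivity),
      ← Real.rpow_natCast, ← Real.rpow_mul (by norm_num), mul_comm (n : ℝ) T]
  have hd0 : 0 < S.delta n := by rw [hd]; positivity
  have h2 : ((S.st n k).1 : ℝ) ≤ (S.delta n)⁻¹ := by
    rw [← one_div, le_div_iff₀ hd0]; exact h1
  rw [hd, mul_inv, inv_inv] at h2
  have h3 : (2 : ℝ) ^ (T * n) ≤ 2 ^ ⌈T * n⌉₊ := by
    rw [← Real.rpow_natCast]
    exact Real.rpow_le_rpow_of_exponent_le (by norm_num) (Nat.le_ceil _)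
  have h4 : ((S.st n k).1 : ℝ) < 2 ^ (⌈T * n⌉₊ + c) := by
    refine h2.trans_lt ?_
    rw [pow_add, mul_comm ((2 : ℝ) ^ ⌈T * n⌉₊)]
    exact mul_lt_mul hc h3 (by positivity) (by positivity)
  exact_mod_cast h4

theorem exists_final (hT : 0 < T) (hT1 : T ≤ 1) (n : ℕ) :
    ∃ k0, ∀ k, k0 ≤ k → (S.st n k).1 = (S.st n k0).1 := by
  obtain ⟨c, hc⟩ := S.exists_c1 hT hT1
  have hb : ∃ M, ∃ k, (S.st n k).1 = M ∧ ∀ k', (S.st n k').1 ≤ M := by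
    have hfin : (Set.range (fun k => (S.st n k).1)).Finite :=
      (Set.finite_lt_nat (2 ^ (⌈T * n⌉₊ + c))).subset (by
        rintro _ ⟨k, rfl⟩
        exact hc n k)
    obtain ⟨M, ⟨k, hk⟩, hM⟩ := hfin.exists_maximal (Set.range_nonempty _)
    refine ⟨M, k, hk, fun k' => ?_⟩
    rcases le_total (S.st n k').1 M with h | h
    · exact h
    · exact hM ⟨k', rfl⟩ h
  obtain ⟨M, k, hk, hM⟩ := hb
  refine ⟨k, fun k' h => le_antisymm (hk ▸ hM k') (S.count_mono n h)⟩

theorem st_const {n k0 : ℕ} (h : ∀ k, k0 ≤ k → (S.st n k).1 = (S.st n k0).1) {k : ℕ}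
    (hk : k0 ≤ k) : S.st n k = S.st n k0 ∧ (S.st n k0).2 < S.G n (k + 1) + 4 := by
  have hstep : ∀ k, k0 ≤ k → (S.st n k).2 < S.G n (k + 1) + 4 ∧ S.st n (k + 1) = S.st n k := by
    intro k hk
    rcases S.st_succ n k with ⟨_, h4⟩ | h4
    · have h1 := h k hk
      have h2 := h (k + 1) (by omega)
      rw [h4] at h2
      dsimp only at h2
      omega
    · exact h4
  have hc : S.st n k = S.st n k0 := by
    induction k, hk using Nat.le_induction with
    | base => rfl
    | succ k hk ih => rw [(hstep k hk).2, ih]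
  exact ⟨hc, hc ▸ (hstep k hk).1⟩

/-- The decoder. -/
def dec (x : (ℕ × ℕ) × List Bool) : Part (List Bool) :=
  (Nat.rfind (fun k => Part.some (decide ((S.st x.1.1 k).1 = bval x.2)))).map
    (fun k => bitsOf x.1.1 ((S.st x.1.1 k).2 + x.1.2 - 4))

theorem partrec_dec : Partrec S.dec := by
  have hst : Computable (fun z : ((ℕ × ℕ) × List Bool) × ℕ => S.st z.1.1.1 z.2) :=
    S.computable_st.comp (Computable.fst.comp (Computable.fst.comp Computable.fst)) Computable.snd
  have hP : Computable₂ (fun (x : (ℕ × ℕ) × List Bool) (k : ℕ) =>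
      decide ((S.st x.1.1 k).1 = bval x.2)) :=
    (Primrec.eq.decide).to_comp.comp (Computable.fst.comp hst)
      (computable_bval.comp (Computable.snd.comp Computable.fst))
  refine (partrec_search hP).map ?_
  exact computable_bitsOf.comp (Computable.fst.comp (Computable.fst.comp Computable.fst))
    (computable_sub (computable_add (Computable.snd.comp hst)
      (Computable.snd.comp (Computable.fst.comp Computable.fst))) (Computable.const 4))

theorem dec_main (hT : 0 < T) (hT1 : T ≤ 1) {c : ℕ}
    (hc : ∀ n k, (S.st n k).1 < 2 ^ (⌈T * n⌉₊ + c)) (n : ℕ) :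
    ∃ e r, e ≤ 4 ∧ r.length = ⌈T * n⌉₊ + c ∧ firstBits (Ffun V T) n ∈ S.dec ((n, e), r) := by
  have hF : 0 ≤ Ffun V T := S.Ffun_nonneg hT hT1
  obtain ⟨k0, hk0⟩ := S.exists_final hT hT1 n
  have hex : ∃ k, (S.st n k).1 = (S.st n k0).1 := ⟨k0, rfl⟩
  obtain ⟨k1, hk1, hmin⟩ : ∃ k1, (S.st n k1).1 = (S.st n k0).1 ∧
      ∀ m < k1, (S.st n m).1 ≠ (S.st n k0).1 :=
    ⟨Nat.find hex, Nat.find_spec hex, fun m hm => Nat.find_min hex hm⟩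
  have hk1' : ∀ k, k1 ≤ k → (S.st n k).1 = (S.st n k1).1 := by
    intro k hk
    rcases le_total k0 k with h | h
    · rw [hk0 k h, hk1]
    · exact le_antisymm ((S.count_mono n h).trans hk1.ge) (S.count_mono n hk)
  set A := ⌊2 ^ n * Ffun V T⌋₊ with hA
  have hA1 : (A : ℝ) ≤ 2 ^ n * Ffun V T := Nat.floor_le (by positivity)
  have hup : (S.st n k1).2 ≤ A + 4 := by
    obtain ⟨k, hk, hkk⟩ := ((S.eventually_G hT hT1 n).and (eventually_ge_atTop (k1 + 1))).exists
    obtain ⟨k, rfl⟩ : ∃ k', k = k' + 1 := ⟨k - 1, by omega⟩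
    have := (S.st_const hk1' (show k1 ≤ k by omega)).2
    rw [← hA] at hk
    omega
  have hlo : A ≤ (S.st n k1).2 := by
    obtain ⟨j, _, hj, _⟩ := S.st_inv hT hT1 n k1
    rw [hj]
    have h1 := S.lt_G n j
    have h2 : (2 : ℝ) ^ n * Ffun V T ≤ 2 ^ n * S.F j :=
      mul_le_mul_of_nonneg_left (S.Ffun_le hT hT1 j) (by positivity)
    have h3 : (A : ℝ) < ((S.G n j + 1 : ℕ) : ℝ) := by push_cast; linarith
    have := Nat.cast_lt.mp h3
    omega
  obtain ⟨r, hr, hrv⟩ := exists_bval _ _ (hc n k0)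
  refine ⟨A + 4 - (S.st n k1).2, r, by omega, hr, ?_⟩
  refine (Part.mem_map_iff _).mpr ⟨k1, ?_, ?_⟩
  · rw [mem_rfind_some]
    dsimp only
    rw [hrv]
    exact ⟨decide_eq_true hk1, fun m hm => decide_eq_false (hmin m hm)⟩
  · rw [firstBits_eq hF, ← hA]
    dsimp only
    congr 1
    omega

theorem sqrt_cast_le (n : ℕ) : (Nat.sqrt n : ℝ) ≤ Real.sqrt n := Real.nat_sqrt_le_real_sqrt

theorem compressible (S : Setup V T) {U : Computer} (hU : Optimal U) (hT : 0 < T)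
    (hT1 : T ≤ 1) : TCompressible U T (Ffun V T) := by
  obtain ⟨c, hc⟩ := S.exists_c1 hT hT1
  obtain ⟨C, hC⟩ := exists_computer computable_pcode pcode_pfx_inj S.partrec_dec (by
    obtain ⟨e, r, _, _, h⟩ := S.dec_main hT hT1 hc 0
    exact ⟨_, _, h⟩)
  obtain ⟨d, hd⟩ := hU.complexity_le C
  set B : ℝ := 2 * Real.sqrt (c + 1) + c + d + 10 with hB
  refine ⟨fun n => 4 * Real.sqrt n + B, ?_, fun n _ => ?_⟩
  · have h1 : Tendsto (fun n : ℕ => (Real.sqrt n)⁻¹) atTop (𝓝 0) :=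
      tendsto_inv_atTop_zero.comp (Real.tendsto_sqrt_atTop.comp tendsto_natCast_atTop_atTop)
    have h2 : Tendsto (fun n : ℕ => B / (n : ℝ)) atTop (𝓝 0) :=
      tendsto_const_div_atTop_nhds_zero_nat B
    have h3 := (h1.const_mul 4).add h2
    simp only [mul_zero, add_zero] at h3
    refine h3.congr (fun n => ?_)
    rw [← Real.sqrt_div_self]
    ring
  · obtain ⟨e, r, he, hr, h⟩ := S.dec_main hT hT1 hc n
    have h1 := hd _ _ (hC _ _ h)
    have h2 : (pcode ((n, e), r)).length ≤
        2 * Nat.sqrt n + 2 + (2 * Nat.sqrt r.length + 2) + 5 + r.length := by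
      have a1 := length_ncode n
      have a2 := length_ncode r.length
      simp only [pcode, List.length_append, length_unary]
      omega
    have h3 : (complexity U (firstBits (Ffun V T) n) : ℝ) ≤
        2 * (Nat.sqrt n : ℝ) + 2 + (2 * (Nat.sqrt r.length : ℝ) + 2) + 5 + r.length + d := by
      exact_mod_cast h1.trans (Nat.add_le_add_right h2 d)
    have h4 : (r.length : ℝ) ≤ T * n + c + 1 := by
      rw [hr]
      have := Nat.ceil_lt_add_one (show 0 ≤ T * (n : ℝ) by positivity)
      push_cast
      linarith
    have h5 := sqrt_cast_le n
    have h6 := sqrt_cast_le r.length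
    have hn0 : (0 : ℝ) ≤ n := Nat.cast_nonneg n
    have h7 : Real.sqrt r.length ≤ Real.sqrt n + Real.sqrt (c + 1) := by
      refine (Real.sqrt_le_sqrt (show (r.length : ℝ) ≤ n + (c + 1) by nlinarith)).trans ?_
      have hc0 : (0 : ℝ) ≤ (c : ℝ) + 1 := by positivity
      have q1 := Real.sq_sqrt hn0
      have q2 := Real.sq_sqrt hc0
      have q3 := mul_nonneg (Real.sqrt_nonneg (n : ℝ)) (Real.sqrt_nonneg ((c : ℝ) + 1))
      apply Real.sqrt_le_iff.mpr
      exact ⟨by positivity, by nlinarith⟩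
    dsimp only
    rw [hB]
    linarith

end Setup

/-- For optimal `V` and computable `T` with `0 < T ≤ 1`, the free
energy `F_V(T) = -T log₂ Z_V(T)` is a well-defined real that is weakly Chaitin
`T`-random and `T`-compressible. -/
theorem freeEnergy_partial_randomness
    (U : Computer) (hU : Optimal U) (V : Computer) (hV : Optimal V)
    (T : ℝ) (hT : 0 < T ∧ T ≤ 1) (hTcomp : ComputableReal T) :
    Summable (fun p : V.f.Dom => boltzmann T p.1) ∧ 0 < Zfun V T ∧
    WeaklyChaitinTRandom U T (Ffun V T) ∧ TCompressible U T (Ffun V T) := by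
  obtain ⟨hT0, hT1⟩ := hT
  obtain ⟨S⟩ := exists_setup V hT0 hT1 hTcomp
  exact ⟨summable_boltzmann V hT0 hT1, Zfun_pos V hT0 hT1, S.weaklyRandom hU hV hT0 hT1,
    S.compressible hU hT0 hT1⟩
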